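/- arXiv:math/0509277 — 4 statements merged into one kernel-verified Lean document; each statement's English description precedes it below -/
import Mathlib

section
/- Let A ⊆ ℝ^d be an open semi-algebraic set and let f : A → ℝ^n be a Nash map. Then all partial derivatives of f of all orders are also semi-algebraic maps, of degree bounded by a function of deg(f), the order of derivation, d and n only. -/
open Set

noncomputable section

/-- The open unit cube `(0,1)^d`. -/
def cubeO (d : ℕ) : Set (Fin d → ℝ) := {x | ∀ i, x i ∈ Set.Ioo (0:ℝ) 1}

/-- The closed unit cube `[0,1]^d`. -/
def cubeC (d : ℕ) : Set (Fin d → ℝ) := {x | ∀ i, x i ∈ Set.Icc (0:ℝ) 1}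

/-- A presentation of a semi-algebraic set: a finite union (list) of conjunctions, each
given by a list of polynomials required to be `> 0` and a list required to be `= 0`. -/
abbrev SAPres (d : ℕ) :=
  List (List (MvPolynomial (Fin d) ℝ) × List (MvPolynomial (Fin d) ℝ))

/-- The set defined by a presentation. -/
def SAPres.toSet {d : ℕ} (p : SAPres d) : Set (Fin d → ℝ) :=
  {x | ∃ c ∈ p, (∀ P ∈ c.1, 0 < MvPolynomial.eval x P) ∧
                (∀ P ∈ c.2, MvPolynomial.eval x P = 0)}

/-- The degree of a presentation: the sum of the total degrees of the polynomials
involved (with multiplicities). -/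
def SAPres.deg {d : ℕ} (p : SAPres d) : ℕ :=
  (p.map fun c =>
    (c.1.map MvPolynomial.totalDegree).sum + (c.2.map MvPolynomial.totalDegree).sum).sum

/-- A set is semi-algebraic if it admits a presentation. -/
def IsSemialgebraic {d : ℕ} (A : Set (Fin d → ℝ)) : Prop := ∃ p : SAPres d, p.toSet = A

/-- The degree of a semi-algebraic set: the minimum degree of its presentations. -/
def SADeg {d : ℕ} (A : Set (Fin d → ℝ)) : ℕ :=
  sInf (SAPres.deg '' {p : SAPres d | p.toSet = A})

/-- The graph of `f : A → ℝ^n`, `A ⊆ ℝ^k`, as a subset of `ℝ^(k+n)`. -/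
def graphSet {k n : ℕ} (A : Set (Fin k → ℝ)) (f : (Fin k → ℝ) → (Fin n → ℝ)) :
    Set (Fin (k + n) → ℝ) :=
  {z | (fun i => z (Fin.castAdd n i)) ∈ A ∧
       (fun j => z (Fin.natAdd k j)) = f fun i => z (Fin.castAdd n i)}

/-- A map is semi-algebraic if its graph is a semi-algebraic set. -/
def IsSAMap {k n : ℕ} (A : Set (Fin k → ℝ)) (f : (Fin k → ℝ) → (Fin n → ℝ)) : Prop :=
  IsSemialgebraic (graphSet A f)

/-- The degree of a semi-algebraic map is the degree of its graph. -/
def SAMapDeg {k n : ℕ} (A : Set (Fin k → ℝ)) (f : (Fin k → ℝ) → (Fin n → ℝ)) : ℕ :=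
  SADeg (graphSet A f)

/-- Scalar-valued version of `IsSAMap`. -/
def IsSAFun {k : ℕ} (A : Set (Fin k → ℝ)) (f : (Fin k → ℝ) → ℝ) : Prop :=
  IsSAMap A fun x (_ : Fin 1) => f x

/-- Scalar-valued version of `SAMapDeg`. -/
def SAFunDeg {k : ℕ} (A : Set (Fin k → ℝ)) (f : (Fin k → ℝ) → ℝ) : ℕ :=
  SAMapDeg A fun x (_ : Fin 1) => f x

/-- `A ⊆ ℝ^d` is an `m`-dimensional analytic submanifold: around each of its points there is
an analytic chart of `ℝ^d` straightening `A` to a coordinate subspace of dimension `m`. -/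
def IsAnalyticSubmanifold {d : ℕ} (A : Set (Fin d → ℝ)) (m : ℕ) : Prop :=
  ∀ x ∈ A, ∃ (U V : Set (Fin d → ℝ)) (φ ψ : (Fin d → ℝ) → (Fin d → ℝ)),
    IsOpen U ∧ IsOpen V ∧ x ∈ U ∧
    AnalyticOnNhd ℝ φ U ∧ AnalyticOnNhd ℝ ψ V ∧
    (∀ y ∈ U, φ y ∈ V) ∧ (∀ z ∈ V, ψ z ∈ U) ∧
    (∀ y ∈ U, ψ (φ y) = y) ∧ (∀ z ∈ V, φ (ψ z) = z) ∧
    φ '' (U ∩ A) = V ∩ {z | ∀ i : Fin d, m ≤ (i : ℕ) → z i = 0}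

/-- A Nash manifold: an analytic submanifold of `ℝ^d` which is a semi-algebraic set. -/
def IsNashManifold {d : ℕ} (A : Set (Fin d → ℝ)) (m : ℕ) : Prop :=
  IsSemialgebraic A ∧ IsAnalyticSubmanifold A m

/-- A Nash map on `A`: a semi-algebraic map which is analytic on `A` (i.e. extends
analytically around every point of `A`). -/
def IsNashMap {k n : ℕ} (A : Set (Fin k → ℝ)) (f : (Fin k → ℝ) → (Fin n → ℝ)) : Prop :=
  IsSAMap A f ∧ ∀ x ∈ A, ∃ (U : Set (Fin k → ℝ)) (g : (Fin k → ℝ) → (Fin n → ℝ)),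
    IsOpen U ∧ x ∈ U ∧ AnalyticOnNhd ℝ g U ∧ Set.EqOn f g (A ∩ U)

/-- Scalar valued Nash map. -/
def IsNashFun {k : ℕ} (A : Set (Fin k → ℝ)) (f : (Fin k → ℝ) → ℝ) : Prop :=
  IsSAFun A f ∧ ∀ x ∈ A, ∃ (U : Set (Fin k → ℝ)) (g : (Fin k → ℝ) → ℝ),
    IsOpen U ∧ x ∈ U ∧ AnalyticOnNhd ℝ g U ∧ Set.EqOn f g (A ∩ U)

/-- The total degree `|α|` of a multi-index. -/
def mIdxDeg {d : ℕ} (α : Fin d → ℕ) : ℕ := ∑ i, α i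

/-- The total order `≼` on multi-indices: `α ≼ β` iff `|α| < |β|`, or `|α| = |β|` and
`α k ≤ β k` at the largest index `k` where they differ (reflexivity included). -/
def mIdxLE {d : ℕ} (α β : Fin d → ℕ) : Prop :=
  α = β ∨ mIdxDeg α < mIdxDeg β ∨
    (mIdxDeg α = mIdxDeg β ∧ ∃ k, α k < β k ∧ ∀ l, k < l → α l = β l)

/-- Pad a multi-index on `Fin l` to one on `Fin d` by zeros (in the last coordinates). -/
def padIdx {l d : ℕ} (β : Fin l → ℕ) : Fin d → ℕ :=
  fun i => if h : (i : ℕ) < l then β ⟨i, h⟩ else 0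

/-- First-order partial derivative in the `i`-th coordinate direction. -/
def pderiv1 {d : ℕ} (i : Fin d) (f : (Fin d → ℝ) → ℝ) : (Fin d → ℝ) → ℝ :=
  fun x => fderiv ℝ f x (Pi.single i 1)

/-- Iterated partial derivative `∂^β f` associated to a multi-index `β`. -/
def mpderiv {d : ℕ} (β : Fin d → ℕ) (f : (Fin d → ℝ) → ℝ) : (Fin d → ℝ) → ℝ :=
  (List.finRange d).foldl (fun g i => (pderiv1 i)^[β i] g) f

/-- A `C⁰`-Nash map `A → (0,1)^n`: a Nash map with values in the open unit cube which
extends continuously to the closure of `A`. -/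
def IsC0NashMap {k n : ℕ} (A : Set (Fin k → ℝ)) (f : (Fin k → ℝ) → (Fin n → ℝ)) : Prop :=
  IsNashMap A f ∧ (∀ x ∈ A, f x ∈ cubeO n) ∧
    ∃ g : (Fin k → ℝ) → (Fin n → ℝ), ContinuousOn g (closure A) ∧ Set.EqOn f g A

/-- Scalar version of `IsC0NashMap`, with values in `(0,1)`. -/
def IsC0NashFun {k : ℕ} (A : Set (Fin k → ℝ)) (f : (Fin k → ℝ) → ℝ) : Prop :=
  IsNashFun A f ∧ (∀ x ∈ A, f x ∈ Set.Ioo (0:ℝ) 1) ∧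
    ∃ g : (Fin k → ℝ) → ℝ, ContinuousOn g (closure A) ∧ Set.EqOn f g A

/-- The bound `‖f‖_α ≤ K`: all partial derivatives `∂^β f` with `β ≼ α` are bounded by `K`
on `A`.  (Multi-indices `β` on the domain are padded by zeros to be compared with `α`.) -/
def CalphaBound {k e : ℕ} (A : Set (Fin k → ℝ)) (α : Fin e → ℕ) (K : ℝ)
    (f : (Fin k → ℝ) → ℝ) : Prop :=
  ∀ β : Fin k → ℕ, mIdxLE (padIdx β) α → ∀ x ∈ A, |mpderiv β f x| ≤ K

/-- A `(C^α,K)`-Nash map: a `C⁰`-Nash map with `‖f‖_α ≤ K`. -/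
def IsCalphaNashMap {k n e : ℕ} (A : Set (Fin k → ℝ)) (α : Fin e → ℕ) (K : ℝ)
    (f : (Fin k → ℝ) → (Fin n → ℝ)) : Prop :=
  IsC0NashMap A f ∧ ∀ j : Fin n, CalphaBound A α K fun x => f x j

/-- Scalar version of `IsCalphaNashMap`. -/
def IsCalphaNashFun {k e : ℕ} (A : Set (Fin k → ℝ)) (α : Fin e → ℕ) (K : ℝ)
    (f : (Fin k → ℝ) → ℝ) : Prop :=
  IsC0NashFun A f ∧ CalphaBound A α K f

/-- A `(C^r,K)`-Nash map: a `C⁰`-Nash map all of whose partial derivatives of order `≤ r`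
are bounded by `K`. -/
def IsCrNashMap {k n : ℕ} (A : Set (Fin k → ℝ)) (r : ℕ) (K : ℝ)
    (f : (Fin k → ℝ) → (Fin n → ℝ)) : Prop :=
  IsC0NashMap A f ∧ ∀ (j : Fin n) (β : Fin k → ℕ), mIdxDeg β ≤ r →
    ∀ x ∈ A, |mpderiv β (fun y => f y j) x| ≤ K

/-- A triangular map `(0,1)^l → (0,1)^d`: the `(d-l+k)`-th coordinate depends only on the
variables `x_k, …, x_l` (stated here with `0`-based indices). -/
def IsTriangular {l d : ℕ} (ψ : (Fin l → ℝ) → (Fin d → ℝ)) : Prop :=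
  l ≤ d ∧ ∀ (j : Fin d) (x y : Fin l → ℝ),
    (∀ i : Fin l, (j : ℕ) ≤ (i : ℕ) + (d - l) → x i = y i) → ψ x j = ψ y j

/-- `A` has maximum dimension `l`: it admits a finite partition into connected Nash
manifolds of dimensions `≤ l`, with `l` attained. -/
def HasMaxDim {d : ℕ} (A : Set (Fin d → ℝ)) (l : ℕ) : Prop :=
  ∃ (N : ℕ) (S : Fin N → Set (Fin d → ℝ)) (m : Fin N → ℕ),
    (∀ i, IsNashManifold (S i) (m i)) ∧ (∀ i, IsConnected (S i)) ∧
    A = (⋃ i, S i) ∧ (∀ i j, i ≠ j → Disjoint (S i) (S j)) ∧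
    (∀ i, m i ≤ l) ∧ (∃ i, m i = l)

/-- A `(C^α,K)`-resolution, with all cardinality/degree bounds at most `B`, of a finite
family of maps `f j : A → (0,1)`, where `A ⊆ (0,1)^d` has maximum dimension `l`. -/
def HasFamilyResolution {d k : ℕ} (l : ℕ) (A : Set (Fin d → ℝ))
    (f : Fin k → (Fin d → ℝ) → ℝ) (α : Fin d → ℕ) (K B : ℝ) : Prop :=
  ∃ (N : ℕ) (φ : Fin N → (Fin l → ℝ) → (Fin d → ℝ)),
    (∀ i, IsTriangular (φ i)) ∧
    (∀ i, IsCalphaNashMap (cubeO l) α K (φ i)) ∧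
    (∀ i j, IsCalphaNashFun (cubeO l) α K fun x => f j (φ i x)) ∧
    closure A = (⋃ i, φ i '' cubeC l) ∧
    (N : ℝ) ≤ B ∧
    (∀ i, (SAMapDeg (cubeO l) (φ i) : ℝ) ≤ B) ∧
    (∀ i j, (SAFunDeg (cubeO l) (fun x => f j (φ i x)) : ℝ) ≤ B)

/-- The open slice `{(x₁,y) ∈ (0,1) × S : f y < x₁ < g y}` in `ℝ^(d+1)`. -/
def bandSlice {d : ℕ} (S : Set (Fin d → ℝ)) (f g : (Fin d → ℝ) → ℝ) :
    Set (Fin (d+1) → ℝ) :=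
  {z | z 0 ∈ Set.Ioo (0:ℝ) 1 ∧ Fin.tail z ∈ S ∧ f (Fin.tail z) < z 0 ∧ z 0 < g (Fin.tail z)}

/-- The graph slice `{(f y, y) : y ∈ S}` in `ℝ^(d+1)`. -/
def graphSlice {d : ℕ} (S : Set (Fin d → ℝ)) (f : (Fin d → ℝ) → ℝ) :
    Set (Fin (d+1) → ℝ) :=
  {z | Fin.tail z ∈ S ∧ z 0 = f (Fin.tail z)}

/-- The Euclidean distance from a point to a set. -/
def eDist {d : ℕ} (x : Fin d → ℝ) (S : Set (Fin d → ℝ)) : ℝ :=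
  sInf ((fun y => Real.sqrt (∑ i, (x i - y i) ^ 2)) '' S)

end

/-- A predicate on `ι → ℝ` is semi-algebraic if it is a finite disjunction of finite conjunctions
of polynomial conditions `0 < P` and `P = 0`. -/
def IsSemialgPred {ι : Type} (S : (ι → ℝ) → Prop) : Prop :=
  ∃ p : List (List (MvPolynomial ι ℝ) × List (MvPolynomial ι ℝ)), ∀ x, S x ↔
    ∃ c ∈ p, (∀ P ∈ c.1, 0 < MvPolynomial.eval x P) ∧ (∀ P ∈ c.2, MvPolynomial.eval x P = 0)

/-- A real function is polynomial. -/
def IsPolyFun {ι : Type} (f : (ι → ℝ) → ℝ) : Prop :=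
  ∃ p : MvPolynomial ι ℝ, ∀ x, f x = MvPolynomial.eval x p

namespace IsPolyFun

variable {ι : Type} {f g : (ι → ℝ) → ℝ}

lemma eval (p : MvPolynomial ι ℝ) : IsPolyFun fun x => MvPolynomial.eval x p := ⟨p, fun _ => rfl⟩

lemma const (c : ℝ) : IsPolyFun fun _ : ι → ℝ => c := ⟨MvPolynomial.C c, by simp⟩

lemma coord (i : ι) : IsPolyFun fun x : ι → ℝ => x i := ⟨MvPolynomial.X i, by simp⟩

lemma add (hf : IsPolyFun f) (hg : IsPolyFun g) : IsPolyFun fun x => f x + g x := by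
  obtain ⟨p, hp⟩ := hf
  obtain ⟨q, hq⟩ := hg
  exact ⟨p + q, fun x => by simp [hp, hq]⟩

lemma mul (hf : IsPolyFun f) (hg : IsPolyFun g) : IsPolyFun fun x => f x * g x := by
  obtain ⟨p, hp⟩ := hf
  obtain ⟨q, hq⟩ := hg
  exact ⟨p * q, fun x => by simp [hp, hq]⟩

lemma neg (hf : IsPolyFun f) : IsPolyFun fun x => - f x := by
  simpa using (const (-1)).mul hf

lemma sub (hf : IsPolyFun f) (hg : IsPolyFun g) : IsPolyFun fun x => f x - g x := by
  simpa [sub_eq_add_neg] using hf.add hg.neg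

lemma comp {κ : Type} (hf : IsPolyFun f) {φ : (κ → ℝ) → ι → ℝ}
    (hφ : ∀ i, IsPolyFun fun y => φ y i) : IsPolyFun fun y => f (φ y) := by
  obtain ⟨p, hp⟩ := hf
  choose q hq using hφ
  refine ⟨MvPolynomial.bind₁ q p, fun y => ?_⟩
  change f (φ y) = _
  rw [hp, ← MvPolynomial.coe_aeval_eq_eval, ← MvPolynomial.coe_aeval_eq_eval]
  simp only [RingHom.coe_coe, MvPolynomial.aeval_bind₁]
  congr 2
  funext i
  simp [hq, MvPolynomial.aeval_eq_eval]

end IsPolyFun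

namespace IsSemialgPred

variable {ι κ : Type} {S T : (ι → ℝ) → Prop} {f g : (ι → ℝ) → ℝ}

lemma congr (h : IsSemialgPred S) (e : ∀ x, T x ↔ S x) : IsSemialgPred T := by
  obtain ⟨p, hp⟩ := h
  exact ⟨p, fun x => (e x).trans (hp x)⟩

lemma false : IsSemialgPred fun _ : ι → ℝ => False := ⟨[], by simp⟩

lemma true : IsSemialgPred fun _ : ι → ℝ => True := ⟨[([], [])], by simp⟩

lemma const (a : Prop) : IsSemialgPred fun _ : ι → ℝ => a := by
  by_cases h : a
  · simpa [h] using true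
  · simpa [h] using false

lemma pos (hf : IsPolyFun f) : IsSemialgPred fun x => 0 < f x := by
  obtain ⟨p, hp⟩ := hf
  exact ⟨[([p], [])], by simp [hp]⟩

lemma eq_zero (hf : IsPolyFun f) : IsSemialgPred fun x => f x = 0 := by
  obtain ⟨p, hp⟩ := hf
  exact ⟨[([], [p])], by simp [hp]⟩

lemma or (hS : IsSemialgPred S) (hT : IsSemialgPred T) : IsSemialgPred fun x => S x ∨ T x := by
  obtain ⟨p, hp⟩ := hS
  obtain ⟨q, hq⟩ := hT
  refine ⟨p ++ q, fun x => ?_⟩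
  simp only [hp, hq, List.mem_append, or_and_right, exists_or]

lemma and (hS : IsSemialgPred S) (hT : IsSemialgPred T) : IsSemialgPred fun x => S x ∧ T x := by
  obtain ⟨p, hp⟩ := hS
  obtain ⟨q, hq⟩ := hT
  refine ⟨p.flatMap fun c => q.map fun c' => (c.1 ++ c'.1, c.2 ++ c'.2), fun x => ?_⟩
  change S x ∧ T x ↔ _
  rw [hp, hq]
  constructor
  · rintro ⟨⟨c, hc, h1, h2⟩, c', hc', h3, h4⟩
    refine ⟨(c.1 ++ c'.1, c.2 ++ c'.2), ?_, ?_, ?_⟩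
    · simp only [List.mem_flatMap, List.mem_map]
      exact ⟨c, hc, c', hc', rfl⟩
    · simpa only [List.mem_append, or_imp, forall_and] using ⟨h1, h3⟩
    · simpa only [List.mem_append, or_imp, forall_and] using ⟨h2, h4⟩
  · rintro ⟨e, he, h1, h2⟩
    simp only [List.mem_flatMap, List.mem_map] at he
    obtain ⟨c, hc, c', hc', rfl⟩ := he
    simp only [List.mem_append, or_imp, forall_and] at h1 h2
    exact ⟨⟨c, hc, h1.1, h2.1⟩, c', hc', h1.2, h2.2⟩

lemma exists_list {α : Type} (l : List α) {S : α → (ι → ℝ) → Prop}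
    (h : ∀ a ∈ l, IsSemialgPred (S a)) : IsSemialgPred fun x => ∃ a ∈ l, S a x := by
  induction l with
  | nil => simpa using false
  | cons a l ih =>
    simpa using (h a (by simp)).or (ih fun b hb => h b (by simp [hb]))

lemma forall_list {α : Type} (l : List α) {S : α → (ι → ℝ) → Prop}
    (h : ∀ a ∈ l, IsSemialgPred (S a)) : IsSemialgPred fun x => ∀ a ∈ l, S a x := by
  induction l with
  | nil => simpa using true
  | cons a l ih =>
    simpa using (h a (by simp)).and (ih fun b hb => h b (by simp [hb]))

lemma exists_finset {α : Type} (s : Finset α) {S : α → (ι → ℝ) → Prop}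
    (h : ∀ a, IsSemialgPred (S a)) : IsSemialgPred fun x => ∃ a ∈ s, S a x := by
  simpa using exists_list s.toList fun a _ => h a

lemma forall_finite {α : Type} [Finite α] {S : α → (ι → ℝ) → Prop}
    (h : ∀ a, IsSemialgPred (S a)) : IsSemialgPred fun x => ∀ a, S a x := by
  have := Fintype.ofFinite α
  simpa using forall_list (Finset.univ : Finset α).toList fun a _ => h a

lemma not (hS : IsSemialgPred S) : IsSemialgPred fun x => ¬ S x := by
  obtain ⟨p, hp⟩ := hS
  have key : ∀ c ∈ p, IsSemialgPred fun x => (∃ P ∈ c.1, (0 < MvPolynomial.eval x (-P) ∨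
      MvPolynomial.eval x P = 0)) ∨ (∃ P ∈ c.2, (0 < MvPolynomial.eval x P ∨
      0 < MvPolynomial.eval x (-P))) := fun c _ =>
    (exists_list _ fun P _ => (pos (.eval _)).or (eq_zero (.eval _))).or
      (exists_list _ fun P _ => (pos (.eval _)).or (pos (.eval _)))
  refine (forall_list p key).congr fun x => ?_
  rw [hp, not_exists]
  refine forall_congr' fun c => ?_
  rw [not_and]
  refine imp_congr_right fun _ => ?_
  rw [not_and_or]
  refine or_congr ?_ ?_
  · simp [le_iff_lt_or_eq]
  · simp [lt_or_lt_iff_ne, eq_comm (a := (0 : ℝ))]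

lemma imp (hS : IsSemialgPred S) (hT : IsSemialgPred T) : IsSemialgPred fun x => S x → T x :=
  (hS.not.or hT).congr fun _ => imp_iff_not_or

lemma lt (hf : IsPolyFun f) (hg : IsPolyFun g) : IsSemialgPred fun x => f x < g x :=
  (pos (hg.sub hf)).congr fun _ => sub_pos.symm

lemma le (hf : IsPolyFun f) (hg : IsPolyFun g) : IsSemialgPred fun x => f x ≤ g x :=
  (lt hg hf).not.congr fun _ => not_lt.symm

lemma comp (hS : IsSemialgPred S) {φ : (κ → ℝ) → ι → ℝ}
    (hφ : ∀ i, IsPolyFun fun y => φ y i) : IsSemialgPred fun y => S (φ y) := by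
  obtain ⟨p, hp⟩ := hS
  refine (exists_list p fun c _ => (forall_list c.1 fun P _ => pos ((IsPolyFun.eval P).comp hφ)).and
    (forall_list c.2 fun P _ => eq_zero ((IsPolyFun.eval P).comp hφ))).congr fun x => hp _

end IsSemialgPred

namespace RealRoots

open Polynomial

/-- Half of the jump of the sign of `h` at `t`. -/
noncomputable def crossing (h : ℝ[X]) (t : ℝ) : ℤ :=
  if Odd (h.rootMultiplicity t) then
    (SignType.sign ((h /ₘ (X - C t) ^ h.rootMultiplicity t).eval t) : ℤ) else 0

lemma rootMultiplicity_X_sub_C_pow_mul {u : ℝ[X]} {t : ℝ} (m : ℕ) (hu : u.eval t ≠ 0) :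
    ((X - C t) ^ m * u).rootMultiplicity t = m := by
  have hu0 : u ≠ 0 := by rintro rfl; simp at hu
  rw [rootMultiplicity_mul (mul_ne_zero (pow_ne_zero _ (X_sub_C_ne_zero t)) hu0),
    rootMultiplicity_X_sub_C_pow, rootMultiplicity_eq_zero hu, add_zero]

lemma crossing_eq {u : ℝ[X]} {t : ℝ} (m : ℕ) (hu : u.eval t ≠ 0) :
    crossing ((X - C t) ^ m * u) t = if Odd m then (SignType.sign (u.eval t) : ℤ) else 0 := by
  rw [crossing, rootMultiplicity_X_sub_C_pow_mul m hu,
    mul_divByMonic_cancel_left _ ((monic_X_sub_C t).pow m)]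

lemma crossing_zero (t : ℝ) : crossing 0 t = 0 := by simp [crossing]

lemma exists_factor {h : ℝ[X]} (hh : h ≠ 0) (t : ℝ) :
    ∃ u : ℝ[X], h = (X - C t) ^ h.rootMultiplicity t * u ∧ u.eval t ≠ 0 := by
  obtain ⟨u, hu, hd⟩ := exists_eq_pow_rootMultiplicity_mul_and_not_dvd h hh t
  exact ⟨u, hu, fun h0 => hd (dvd_iff_isRoot.2 h0)⟩

lemma sign_eval_eq_of_no_root_Ici {g : ℝ[X]} {r : ℝ} (hr : ∀ t, r ≤ t → g.eval t ≠ 0) :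
    SignType.sign (g.eval r) = SignType.sign g.leadingCoeff := by
  have key : ∀ g : ℝ[X], (∀ t, r ≤ t → g.eval t ≠ 0) → 0 < g.leadingCoeff → 0 < g.eval r := by
    intro g hr hlc
    by_contra! hneg
    have hneg := lt_of_le_of_ne hneg (hr r le_rfl)
    have hdeg : 0 < g.degree := by
      by_contra! hd
      rw [eq_C_of_degree_le_zero hd] at hlc hneg
      simp only [leadingCoeff_C, eval_C] at hlc hneg
      linarith
    have htop := tendsto_atTop_of_leadingCoeff_nonneg g hdeg hlc.le
    obtain ⟨s, hs0, hs⟩ :=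
      ((htop.eventually_gt_atTop 0).and (Filter.eventually_ge_atTop r)).exists
    obtain ⟨c, hc, hc0⟩ := intermediate_value_Icc hs g.continuousOn
      (show (0 : ℝ) ∈ Set.Icc (g.eval r) (g.eval s) from ⟨hneg.le, hs0.le⟩)
    exact hr c hc.1 hc0
  have hg : g ≠ 0 := by rintro rfl; simpa using hr r le_rfl
  rcases lt_or_gt_of_ne (leadingCoeff_ne_zero.2 hg) with h | h
  · have := key (-g) (by simpa using hr) (by simpa using h)
    rw [sign_neg h, sign_neg (by simpa using this)]
  · rw [sign_pos h, sign_pos (key g hr h)]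

lemma even_natDegree_of_no_root {g : ℝ[X]} (hg : ∀ t, g.eval t ≠ 0) : Even g.natDegree := by
  have h1 := sign_eval_eq_of_no_root_Ici (g := g) (r := 0) fun t _ => hg t
  have h2 := sign_eval_eq_of_no_root_Ici (g := g.comp (-X)) (r := 0) fun t _ => by
    simpa using hg (-t)
  have hlc : (g.comp (-X)).leadingCoeff = g.leadingCoeff * (-1) ^ g.natDegree := by
    rw [leadingCoeff_comp (by simp)]
    simp
  rw [hlc] at h2
  simp only [eval_comp, eval_neg, eval_X, neg_zero] at h2
  by_contra ho
  rw [Nat.not_even_iff_odd] at ho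
  rw [ho.neg_one_pow, mul_neg_one, Left.sign_neg, h1] at h2
  have h0 : SignType.sign g.leadingCoeff ≠ 0 := by
    rw [← h1, sign_ne_zero]
    exact hg 0
  generalize SignType.sign g.leadingCoeff = s at h0 h2
  cases s <;> simp_all

lemma sum_crossing (h : ℝ[X]) : ∑ t ∈ h.roots.toFinset, crossing h t =
    if Odd h.natDegree then (SignType.sign h.leadingCoeff : ℤ) else 0 := by
  induction hn : h.natDegree using Nat.strong_induction_on generalizing h with
  | _ n ih =>
  by_cases hh : h = 0
  · subst hh
    simp only [natDegree_zero] at hn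
    simp [← hn]
  by_cases hroot : h.roots.toFinset.Nonempty
  swap
  · rw [Finset.not_nonempty_iff_eq_empty] at hroot
    have : Even h.natDegree := even_natDegree_of_no_root fun t ht => by
      have : t ∈ h.roots.toFinset := by simpa [hh] using ht
      simp [hroot] at this
    rw [hroot, if_neg (by rw [← hn]; exact Nat.not_odd_iff_even.2 this), Finset.sum_empty]
  set r := h.roots.toFinset.max' hroot with hr
  have hrmem : r ∈ h.roots.toFinset := Finset.max'_mem _ _
  have hmax : ∀ t ∈ h.roots.toFinset, t ≤ r := fun t ht => Finset.le_max' _ t ht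
  clear_value r
  obtain ⟨g, hg, hgr⟩ := exists_factor hh r
  have hm : 0 < h.rootMultiplicity r := (rootMultiplicity_pos hh).2 (by simpa [hh] using hrmem)
  set m := h.rootMultiplicity r with hmdef
  clear_value m
  have hg0 : g ≠ 0 := by rintro rfl; simp at hgr
  have hroots : h.roots.toFinset = insert r g.roots.toFinset := by
    ext t
    simp only [Multiset.mem_toFinset, mem_roots hh, Finset.mem_insert, mem_roots hg0, IsRoot.def]
    rw [hg]
    simp [hm.ne', sub_eq_zero]
  have hrg : r ∉ g.roots.toFinset := by simpa [hg0] using hgr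
  have hdeg : h.natDegree = m + g.natDegree := by
    rw [hg, natDegree_mul (pow_ne_zero _ (X_sub_C_ne_zero r)) hg0]
    simp
  have hlc : h.leadingCoeff = g.leadingCoeff := by
    rw [hg]; simp
  have hsgn : SignType.sign (g.eval r) = SignType.sign g.leadingCoeff := by
    refine sign_eval_eq_of_no_root_Ici fun t ht h0 => ?_
    have h1 : t ∈ g.roots.toFinset := by simpa [hg0] using h0
    have h2 := hmax t (by rw [hroots]; exact Finset.mem_insert_of_mem h1)
    exact hrg (le_antisymm ht h2 ▸ h1)
  have hlt : ∀ t ∈ g.roots.toFinset, crossing h t = (-1) ^ m * crossing g t := by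
    intro t ht
    have htr : t < r := lt_of_le_of_ne (hmax t (by rw [hroots]; exact Finset.mem_insert_of_mem ht))
      (fun e => hrg (e ▸ ht))
    obtain ⟨v, hv, hvt⟩ := exists_factor hg0 t
    have hv2 : ((X - C r) ^ m * v).eval t ≠ 0 := by
      simp [hvt, sub_eq_zero, htr.ne]
    have e1 := crossing_eq (g.rootMultiplicity t) hvt
    have e2 := crossing_eq (g.rootMultiplicity t) hv2
    rw [mul_left_comm, ← hv, ← hg] at e2
    rw [← hv] at e1
    rw [e1, e2]
    simp [sign_mul, sign_pow, sign_neg (sub_neg.2 htr)]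
  have hr1 := crossing_eq m hgr
  rw [← hg] at hr1
  have hih := ih g.natDegree (by omega) g rfl
  rw [hroots, Finset.sum_insert hrg, Finset.sum_congr rfl hlt, ← Finset.mul_sum, hih, hr1, hsgn,
    ← hn, hdeg, hlc]
  rcases Nat.even_or_odd m with h1 | h1 <;> rcases Nat.even_or_odd g.natDegree with h2 | h2
  · rw [if_neg (Nat.not_odd_iff_even.2 h1), if_neg (Nat.not_odd_iff_even.2 h2),
      if_neg (Nat.not_odd_iff_even.2 (h1.add h2))]
    simp
  · rw [if_neg (Nat.not_odd_iff_even.2 h1), if_pos h2, if_pos (h1.add_odd h2), h1.neg_one_pow]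
    simp
  · rw [if_pos h1, if_neg (Nat.not_odd_iff_even.2 h2), if_pos (h1.add_even h2)]
    simp
  · rw [if_pos h1, if_pos h2, if_neg (Nat.not_odd_iff_even.2 (h1.add_odd h2)), h1.neg_one_pow]
    simp

/-- The Cauchy index of the rational function `g / f`. -/
noncomputable def cauchyIndex (f g : ℝ[X]) : ℤ :=
  ∑ t ∈ f.roots.toFinset,
    if g.rootMultiplicity t < f.rootMultiplicity t then crossing (f * g) t else 0

lemma cauchyIndex_zero_left (g : ℝ[X]) : cauchyIndex 0 g = 0 := by simp [cauchyIndex]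

lemma cauchyIndex_zero_right (f : ℝ[X]) : cauchyIndex f 0 = 0 := by
  simp [cauchyIndex, crossing_zero]

lemma cauchyIndex_add_mul (f g k : ℝ[X]) : cauchyIndex f (g + k * f) = cauchyIndex f g := by
  by_cases hf : f = 0
  · simp [hf, cauchyIndex]
  refine Finset.sum_congr rfl fun t ht => ?_
  have hmf : 0 < f.rootMultiplicity t := (rootMultiplicity_pos hf).2 (by simpa [hf] using ht)
  obtain ⟨u, hu, hut⟩ := exists_factor hf t
  set m := f.rootMultiplicity t with hmdef
  clear_value m
  have zero_of_dvd : ∀ a : ℝ[X], (X - C t) ^ m ∣ a →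
      (if a.rootMultiplicity t < m then crossing (f * a) t else 0) = 0 := by
    intro a ha
    by_cases ha0 : a = 0
    · simp [ha0, crossing_zero]
    · rw [if_neg (not_lt.2 ((le_rootMultiplicity_iff ha0).2 ha))]
  have hfdvd : (X - C t) ^ m ∣ k * f := by
    rw [hu]; exact (Dvd.intro _ rfl).mul_left _
  by_cases hg : (X - C t) ^ m ∣ g
  · rw [zero_of_dvd g hg, zero_of_dvd _ (dvd_add hg hfdvd)]
  · have hg0 : g ≠ 0 := by rintro rfl; simp at hg
    have hlt : g.rootMultiplicity t < m := by
      by_contra! hle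
      exact hg ((le_rootMultiplicity_iff hg0).1 hle)
    obtain ⟨v, hv, hvt⟩ := exists_factor hg0 t
    set l := g.rootMultiplicity t with hldef
    clear_value l
    obtain ⟨e, rfl⟩ : ∃ e, m = l + (e + 1) := ⟨m - l - 1, by omega⟩
    have hw : (v + k * ((X - C t) ^ (e + 1) * u)).eval t = v.eval t := by simp
    have hsum : g + k * f = (X - C t) ^ l * (v + k * ((X - C t) ^ (e + 1) * u)) := by
      rw [hv, hu, pow_add]; ring
    have hmul : ∀ w : ℝ[X], f * ((X - C t) ^ l * w) = (X - C t) ^ (l + (e + 1) + l) * (u * w) := by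
      intro w
      rw [hu, pow_add, pow_add]; ring
    rw [hsum, rootMultiplicity_X_sub_C_pow_mul l (by rwa [hw]), if_pos hlt, if_pos hlt, hmul,
      crossing_eq _ (by rw [eval_mul, hw]; exact mul_ne_zero hut hvt)]
    conv_rhs => rw [hv, hmul, crossing_eq _ (by rw [eval_mul]; exact mul_ne_zero hut hvt)]
    rw [eval_mul, hw, eval_mul]

lemma cauchyIndex_C_mul (f g : ℝ[X]) {c : ℝ} (hc : 0 < c) :
    cauchyIndex f (C c * g) = cauchyIndex f g := by
  refine Finset.sum_congr rfl fun t _ => ?_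
  by_cases hg : g = 0
  · simp [hg]
  by_cases hf : f = 0
  · simp [hf]
  obtain ⟨u, hu, hut⟩ := exists_factor (mul_ne_zero hf hg) t
  have h1 := crossing_eq ((f * g).rootMultiplicity t) hut
  have h2 := crossing_eq (u := C c * u) ((f * g).rootMultiplicity t)
    (by simpa using ⟨hc.ne', hut⟩)
  have : (X - C t) ^ ((f * g).rootMultiplicity t) * (C c * u) = f * (C c * g) := by
    rw [mul_left_comm, ← hu]; ring
  rw [this] at h2
  rw [← hu] at h1
  have h3 : (C c * g).rootMultiplicity t = g.rootMultiplicity t := by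
    rw [← count_roots, roots_C_mul _ hc.ne', count_roots]
  rw [h1, h2, h3]
  simp [sign_mul, sign_pos hc]

lemma cauchyIndex_inv {f g : ℝ[X]} (hf : f ≠ 0) (hg : g ≠ 0) :
    cauchyIndex f g + cauchyIndex g f = if Odd (f * g).natDegree then
      (SignType.sign (f * g).leadingCoeff : ℤ) else 0 := by
  have hfg := mul_ne_zero hf hg
  rw [← sum_crossing]
  have extend : ∀ a b : ℝ[X], a ≠ 0 → a.roots.toFinset ⊆ (f * g).roots.toFinset →
      cauchyIndex a b = ∑ t ∈ (f * g).roots.toFinset,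
        if b.rootMultiplicity t < a.rootMultiplicity t then crossing (a * b) t else 0 := by
    intro a b ha hsub
    refine Finset.sum_subset hsub fun t _ ht => ?_
    have : a.rootMultiplicity t = 0 := rootMultiplicity_eq_zero (by simpa [ha] using ht)
    simp [this]
  rw [extend f g hf (by rw [roots_mul hfg, Multiset.toFinset_add]; exact Finset.subset_union_left),
    extend g f hg (by rw [roots_mul hfg, Multiset.toFinset_add]; exact Finset.subset_union_right),
    ← Finset.sum_add_distrib]
  refine Finset.sum_congr rfl fun t _ => ?_
  rcases lt_trichotomy (g.rootMultiplicity t) (f.rootMultiplicity t) with h | h | h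
  · simp [h, h.not_gt]
  · have : ¬ Odd ((f * g).rootMultiplicity t) := by
      rw [rootMultiplicity_mul hfg, h, ← two_mul]
      simp
    simp [h, crossing, this]
  · simp [h, h.not_gt, mul_comm g f]

lemma cauchyIndex_derivative_mul (p q : ℝ[X]) :
    cauchyIndex p (derivative p * q) =
      ∑ t ∈ p.roots.toFinset, (SignType.sign (q.eval t) : ℤ) := by
  by_cases hp : p = 0
  · simp [hp, cauchyIndex]
  refine Finset.sum_congr rfl fun t ht => ?_
  have hroot : p.IsRoot t := by simpa [hp] using ht
  obtain ⟨u, hu, hut⟩ := exists_factor hp t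
  obtain ⟨n, hn⟩ : ∃ n, p.rootMultiplicity t = n + 1 :=
    ⟨_, (Nat.succ_pred_eq_of_pos ((rootMultiplicity_pos hp).2 hroot)).symm⟩
  rw [hn] at hu ⊢
  have hd : derivative p = (X - C t) ^ n * (C ((n : ℝ) + 1) * u + (X - C t) * derivative u) := by
    rw [hu]
    simp [derivative_pow]
    ring
  by_cases hq : q.eval t = 0
  · rw [hq, sign_zero]
    obtain ⟨v, rfl⟩ := dvd_iff_isRoot.2 hq
    have hdvd : (X - C t) ^ (n + 1) ∣ derivative p * ((X - C t) * v) := by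
      rw [hd]
      exact ⟨(C ((n : ℝ) + 1) * u + (X - C t) * derivative u) * v, by ring⟩
    by_cases h0 : derivative p * ((X - C t) * v) = 0
    · simp [h0, crossing_zero]
    · rw [if_neg (not_lt.2 ((le_rootMultiplicity_iff h0).2 hdvd))]
      simp
  · have hne : ((C ((n : ℝ) + 1) * u + (X - C t) * derivative u) * q).eval t ≠ 0 := by
      simp [hut, hq, Nat.cast_add_one_ne_zero n]
    have hm := rootMultiplicity_X_sub_C_pow_mul n hne
    have e2 : p * (derivative p * q) = (X - C t) ^ (2 * n + 1) *
        (u * ((C ((n : ℝ) + 1) * u + (X - C t) * derivative u) * q)) := by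
      rw [hd]
      nth_rw 1 [hu]
      ring
    rw [e2, crossing_eq _ (by rw [eval_mul]; exact mul_ne_zero hut hne), hd, mul_assoc, hm,
      if_pos (Nat.lt_succ_self n), if_pos (odd_two_mul_add_one n)]
    have e3 : (u * ((C ((n : ℝ) + 1) * u + (X - C t) * derivative u) * q)).eval t =
        (((n : ℝ) + 1) * (u.eval t * u.eval t)) * q.eval t := by
      simp; ring
    rw [e3, sign_mul, sign_pos (mul_pos (by positivity) (mul_self_pos.2 hut)), one_mul]

lemma exists_pos_of_leadingCoeff_pos {L : List ℝ[X]} (hL : ∀ s ∈ L, 0 < s.leadingCoeff) :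
    ∃ t, ∀ s ∈ L, 0 < s.eval t := by
  have key : ∀ s ∈ L, ∀ᶠ t in Filter.atTop, 0 < s.eval t := by
    intro s hs
    by_cases hd : 0 < s.degree
    · exact (tendsto_atTop_of_leadingCoeff_nonneg s hd (hL s hs).le).eventually_gt_atTop 0
    · have h := hL s hs
      rw [eq_C_of_degree_le_zero (not_lt.1 hd)] at h ⊢
      exact Filter.Eventually.of_forall fun t => by simpa using h
  exact ((Filter.eventually_all_finite L.finite_toSet).2 key).exists

lemma exists_pos_iff (L : List ℝ[X]) : (∃ t, ∀ s ∈ L, 0 < s.eval t) ↔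
    (∀ s ∈ L, 0 < s.leadingCoeff) ∨ (∀ s ∈ L, 0 < (s.comp (-X)).leadingCoeff) ∨
      (derivative L.prod ≠ 0 ∧ ∃ t, (derivative L.prod).eval t = 0 ∧ ∀ s ∈ L, 0 < s.eval t) := by
  constructor
  swap
  · rintro (h | h | ⟨-, t, -, h⟩)
    · exact exists_pos_of_leadingCoeff_pos h
    · obtain ⟨t, ht⟩ := exists_pos_of_leadingCoeff_pos (L := L.map fun s => s.comp (-X))
        (by simpa using h)
      exact ⟨-t, by simpa using ht⟩
    · exact ⟨t, h⟩
  rintro ⟨t, ht⟩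
  by_cases h1 : ∀ s ∈ L, ∀ r, t ≤ r → s.eval r ≠ 0
  · left
    intro s hs
    have := sign_eval_eq_of_no_root_Ici (h1 s hs)
    rwa [sign_pos (ht s hs), eq_comm, sign_eq_one_iff] at this
  right
  by_cases h2 : ∀ s ∈ L, ∀ r, r ≤ t → s.eval r ≠ 0
  · left
    intro s hs
    have := sign_eval_eq_of_no_root_Ici (g := s.comp (-X)) (r := -t) fun r hr => by
      simpa using h2 s hs (-r) (by linarith)
    rwa [sign_pos (by simpa using ht s hs), eq_comm, sign_eq_one_iff] at this
  right
  push Not at h1 h2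
  obtain ⟨s₁, hs₁, r₁, hr₁, h1⟩ := h1
  obtain ⟨s₂, hs₂, r₂, hr₂, h2⟩ := h2
  set Q := L.prod with hQ
  have evalQ : ∀ r, Q.eval r = (L.map fun s => s.eval r).prod := fun r => by
    rw [hQ, ← coe_evalRingHom, map_list_prod]
  have hroot : ∀ s ∈ L, ∀ r, s.eval r = 0 → Q.eval r = 0 := fun s hs r h0 => by
    rw [evalQ]
    exact List.prod_eq_zero (List.mem_map.2 ⟨s, hs, h0⟩)
  have hQt : Q.eval t ≠ 0 := by
    rw [evalQ]
    refine List.prod_ne_zero fun h => ?_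
    obtain ⟨s, hs, h⟩ := List.mem_map.1 h
    exact (ht s hs).ne' h
  have hQ0 : Q ≠ 0 := by rintro h; simp [h] at hQt
  have hne : ∀ r, Q.eval r = 0 → r ≠ t := by rintro r h rfl; exact hQt h
  have hA : (Q.roots.toFinset.filter (· < t)).Nonempty := ⟨r₂, by
    simpa [hQ0] using ⟨hroot _ hs₂ _ h2, lt_of_le_of_ne hr₂ (hne _ (hroot _ hs₂ _ h2))⟩⟩
  have hB : (Q.roots.toFinset.filter (t < ·)).Nonempty := ⟨r₁, by
    simpa [hQ0] using ⟨hroot _ hs₁ _ h1, lt_of_le_of_ne hr₁ (hne _ (hroot _ hs₁ _ h1)).symm⟩⟩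
  obtain ⟨a, hamem, hamax⟩ : ∃ a ∈ Q.roots.toFinset.filter (· < t),
      ∀ r ∈ Q.roots.toFinset.filter (· < t), r ≤ a :=
    ⟨_, Finset.max'_mem _ hA, fun r hr => Finset.le_max' _ r hr⟩
  obtain ⟨b, hbmem, hbmin⟩ : ∃ b ∈ Q.roots.toFinset.filter (t < ·),
      ∀ r ∈ Q.roots.toFinset.filter (t < ·), b ≤ r :=
    ⟨_, Finset.min'_mem _ hB, fun r hr => Finset.min'_le _ r hr⟩
  obtain ⟨ha0, hat⟩ : Q.eval a = 0 ∧ a < t := by simpa [hQ0] using hamem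
  obtain ⟨hb0, htb⟩ : Q.eval b = 0 ∧ t < b := by simpa [hQ0] using hbmem
  have hgap : ∀ r, a < r → r < b → Q.eval r ≠ 0 := by
    intro r har hrb h0
    rcases lt_or_gt_of_ne (hne r h0) with h | h
    · exact har.not_ge (hamax r (by simpa [hQ0] using ⟨h0, h⟩))
    · exact hrb.not_ge (hbmin r (by simpa [hQ0] using ⟨h0, h⟩))
  obtain ⟨c, hc, hc0⟩ := exists_deriv_eq_zero (f := fun r => Q.eval r) (hat.trans htb)
    Q.continuousOn (by rw [ha0, hb0])
  rw [Polynomial.deriv] at hc0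
  refine ⟨fun h => ?_, c, hc0, fun s hs => ?_⟩
  · rw [eq_C_of_natDegree_eq_zero (derivative_eq_zero.1 h)] at hQt ha0
    simp only [eval_C] at hQt ha0
    exact hQt ha0
  · by_contra! hneg
    obtain ⟨r, hr, hr0⟩ := intermediate_value_uIcc (a := c) (b := t) (f := fun r => s.eval r)
      s.continuousOn (Set.mem_uIcc.2 (Or.inl ⟨hneg, (ht s hs).le⟩))
    refine hgap r ?_ ?_ (hroot s hs r hr0)
    · exact (lt_min hc.1 hat).trans_le hr.1
    · exact hr.2.trans_lt (max_lt hc.2 htb)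

end RealRoots

/-- An integer-valued function on `ι → ℝ` with finitely many values and semi-algebraic fibres. -/
def IsTame {ι : Type} (F : (ι → ℝ) → ℤ) : Prop :=
  (Set.range F).Finite ∧ ∀ k, IsSemialgPred fun x => F x = k

namespace IsTame

variable {ι : Type} {F G H : (ι → ℝ) → ℤ} {S : (ι → ℝ) → Prop}

lemma const (k : ℤ) : IsTame fun _ : ι → ℝ => k :=
  ⟨(Set.finite_singleton k).subset (by rintro _ ⟨x, rfl⟩; rfl), fun _ => .const _⟩

lemma congr (hF : IsTame F) (e : ∀ x, G x = F x) : IsTame G := by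
  rwa [funext e]

lemma pred₂ (hF : IsTame F) (hG : IsTame G) (Q : ℤ → ℤ → Prop) :
    IsSemialgPred fun x => Q (F x) (G x) := by
  refine (IsSemialgPred.exists_finset hF.1.toFinset fun a =>
    IsSemialgPred.exists_finset hG.1.toFinset fun b =>
      ((hF.2 a).and (hG.2 b)).and (.const (Q a b))).congr fun x => ?_
  simp

lemma pred (hF : IsTame F) (Q : ℤ → Prop) : IsSemialgPred fun x => Q (F x) :=
  hF.pred₂ hF fun a _ => Q a

lemma map₂ (hF : IsTame F) (hG : IsTame G) (φ : ℤ → ℤ → ℤ) : IsTame fun x => φ (F x) (G x) := by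
  refine ⟨(hF.1.image2 φ hG.1).subset ?_, fun k => hF.pred₂ hG fun a b => φ a b = k⟩
  rintro _ ⟨x, rfl⟩
  exact Set.mem_image2_of_mem ⟨x, rfl⟩ ⟨x, rfl⟩

lemma piecewise (hS : IsSemialgPred S) (hF : IsTame F) (hG : IsTame G)
    (h1 : ∀ x, S x → H x = F x) (h2 : ∀ x, ¬ S x → H x = G x) : IsTame H := by
  refine ⟨(hF.1.union hG.1).subset ?_, fun k =>
    ((hS.and (hF.2 k)).or (hS.not.and (hG.2 k))).congr fun x => ?_⟩
  · rintro _ ⟨x, rfl⟩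
    by_cases hx : S x
    · exact Or.inl ⟨x, (h1 x hx).symm⟩
    · exact Or.inr ⟨x, (h2 x hx).symm⟩
  · by_cases hx : S x
    · simp [hx, h1]
    · simp [hx, h2]

lemma sign {f : (ι → ℝ) → ℝ} (hf : IsPolyFun f) : IsTame fun x => (SignType.sign (f x) : ℤ) := by
  refine piecewise (.pos hf) (const 1) (piecewise (.eq_zero hf) (const 0) (const (-1))
    (H := fun x => if f x = 0 then 0 else -1) ?_ ?_) ?_ ?_
  · intro x hx; simp [hx]
  · intro x hx; simp [hx]
  · intro x hx; simp [sign_pos hx]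
  · intro x hx
    by_cases h0 : f x = 0
    · simp [h0]
    · simp [h0, sign_neg (lt_of_le_of_ne (not_lt.1 hx) h0)]

end IsTame

namespace ParametricPolynomial

open Polynomial RealRoots

variable {ι : Type}

/-- Specialization of the coefficients of a polynomial at a point. -/
noncomputable def spec (x : ι → ℝ) : (MvPolynomial ι ℝ)[X] →+* ℝ[X] :=
  mapRingHom (MvPolynomial.eval x)

lemma coeff_spec (x : ι → ℝ) (p : (MvPolynomial ι ℝ)[X]) (n : ℕ) :
    (spec x p).coeff n = MvPolynomial.eval x (p.coeff n) := by simp [spec]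

lemma degree_erase_lt {R : Type*} [CommRing R] {p : R[X]} {n : ℕ} (hp : p.degree < (n + 1 : ℕ)) :
    (p.erase n).degree < n := by
  rw [degree_lt_iff_coeff_zero] at hp ⊢
  intro m hm
  rw [coeff_erase]
  split_ifs with h
  · rfl
  · exact hp m (by omega)

lemma spec_erase {x : ι → ℝ} {p : (MvPolynomial ι ℝ)[X]} {n : ℕ}
    (h : MvPolynomial.eval x (p.coeff n) = 0) : spec x (p.erase n) = spec x p := by
  ext m
  rw [coeff_spec, coeff_spec, coeff_erase]
  split_ifs with hm
  · rw [hm, h, map_zero]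
  · rfl

lemma natDegree_spec {x : ι → ℝ} {p : (MvPolynomial ι ℝ)[X]} {n : ℕ}
    (hp : p.degree < (n + 1 : ℕ)) (h : MvPolynomial.eval x (p.coeff n) ≠ 0) :
    (spec x p).natDegree = n := by
  refine natDegree_eq_of_le_of_coeff_ne_zero ?_ (by rwa [coeff_spec])
  refine natDegree_le_iff_coeff_eq_zero.2 fun m hm => ?_
  rw [coeff_spec, (degree_lt_iff_coeff_zero _ _).1 hp m (by omega), map_zero]

lemma eq_zero_of_degree_lt_zero {R : Type*} [CommRing R] {p : R[X]} (hp : p.degree < (0 : ℕ)) :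
    p = 0 := by
  rw [degree_lt_iff_coeff_zero] at hp
  ext m
  simpa using hp m (Nat.zero_le m)

lemma isSemialgPred_spec_eq_zero (p : (MvPolynomial ι ℝ)[X]) :
    IsSemialgPred fun x => spec x p = 0 := by
  refine (IsSemialgPred.forall_list p.support.toList fun n _ =>
    IsSemialgPred.eq_zero (.eval (p.coeff n))).congr fun x => ?_
  rw [Polynomial.ext_iff]
  simp only [coeff_spec, coeff_zero, Finset.mem_toList, mem_support_iff]
  refine forall_congr' fun n => ⟨fun h _ => h, fun h => ?_⟩
  by_cases h0 : p.coeff n = 0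
  · simp [h0]
  · exact h h0

lemma isTame_degree_sign (φ : ℕ → ℤ → ℤ) (p : (MvPolynomial ι ℝ)[X]) : IsTame fun x =>
    φ (spec x p).natDegree (SignType.sign (spec x p).leadingCoeff) := by
  obtain ⟨n, hn⟩ : ∃ n : ℕ, p.degree < n :=
    ⟨p.natDegree + 1, degree_le_natDegree.trans_lt (by exact_mod_cast Nat.lt_succ_self _)⟩
  induction n generalizing p with
  | zero =>
    rw [eq_zero_of_degree_lt_zero hn]
    simpa using IsTame.const (φ 0 0)
  | succ n ih =>
    refine IsTame.piecewise (.eq_zero (.eval (p.coeff n))) (ih (p.erase n) (degree_erase_lt hn))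
      ((IsTame.sign (.eval (p.coeff n))).map₂ (.const 0) fun a _ => φ n a) ?_ ?_
    · intro x hx
      rw [spec_erase hx]
    · intro x hx
      rw [leadingCoeff, natDegree_spec hn hx, coeff_spec]

lemma exists_pseudo_division {R : Type*} [CommRing R] {g : R[X]} {n : ℕ}
    (hg : g.degree < (n + 1 : ℕ)) (f : R[X]) :
    ∃ (k : ℕ) (q r : R[X]), C (g.coeff n ^ (2 * k)) * f = r + q * g ∧ r.degree < n := by
  obtain ⟨N, hN⟩ : ∃ N : ℕ, f.degree < N :=
    ⟨f.natDegree + 1, degree_le_natDegree.trans_lt (by exact_mod_cast Nat.lt_succ_self _)⟩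
  induction N generalizing f with
  | zero => exact ⟨0, 0, 0, by simp [eq_zero_of_degree_lt_zero hN], by simp [bot_lt_iff_ne_bot]⟩
  | succ N ih =>
    by_cases hNn : N < n
    · exact ⟨0, 0, f, by simp, hN.trans_le (by exact_mod_cast hNn)⟩
    obtain ⟨k, q, r, h, hr⟩ := ih (C (g.coeff n ^ 2) * f -
        C (g.coeff n * f.coeff N) * X ^ (N - n) * g) (by
      rw [degree_lt_iff_coeff_zero] at hN hg ⊢
      intro m hm
      rw [coeff_sub, coeff_C_mul, mul_assoc, coeff_C_mul, coeff_X_pow_mul',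
        if_pos (show N - n ≤ m by omega)]
      rcases hm.eq_or_lt with rfl | hm
      · rw [show N - (N - n) = n by omega]; ring
      · rw [hN m (by omega), hg (m - (N - n)) (by omega)]; ring)
    refine ⟨k + 1, q + C (g.coeff n ^ (2 * k)) * (C (g.coeff n * f.coeff N) * X ^ (N - n)), r, ?_, hr⟩
    rw [mul_sub, ← mul_assoc, ← C_mul, ← pow_add, sub_eq_iff_eq_add] at h
    rw [show 2 * (k + 1) = 2 * k + 2 by ring, h]
    ring

lemma isTame_cauchyIndex (f g : (MvPolynomial ι ℝ)[X]) :
    IsTame fun x => cauchyIndex (spec x f) (spec x g) := by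
  obtain ⟨n, hn⟩ : ∃ n : ℕ, g.degree < n :=
    ⟨g.natDegree + 1, degree_le_natDegree.trans_lt (by exact_mod_cast Nat.lt_succ_self _)⟩
  induction n generalizing f g with
  | zero =>
    rw [eq_zero_of_degree_lt_zero hn]
    simpa [cauchyIndex_zero_right] using IsTame.const 0
  | succ n ih =>
    obtain ⟨k, q, r, hdiv, hr⟩ := exists_pseudo_division hn f
    classical
    have hinv : IsTame fun x => if spec x f = 0 then 0 else
        (if Odd (spec x (f * g)).natDegree then
          (SignType.sign (spec x (f * g)).leadingCoeff : ℤ) else 0) -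
          cauchyIndex (spec x g) (spec x r) :=
      IsTame.piecewise (isSemialgPred_spec_eq_zero f) (.const 0)
        ((isTame_degree_sign (fun d s => if Odd d then s else 0) (f * g)).map₂ (ih g r hr)
          fun a b => a - b) (fun x hx => if_pos hx) fun x hx => if_neg hx
    refine IsTame.piecewise (.eq_zero (.eval (g.coeff n))) (ih f (g.erase n) (degree_erase_lt hn))
      hinv (fun x hx => by rw [spec_erase hx]) fun x hx => ?_
    by_cases hf : spec x f = 0
    · rw [if_pos hf, hf, cauchyIndex_zero_left]
    · have hg : spec x g ≠ 0 := fun h => hx (by rw [← coeff_spec, h, coeff_zero])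
      have hdivx := congrArg (spec x) hdiv
      have hC : ∀ a, spec x (C a) = C (MvPolynomial.eval x a) := fun a => by simp [spec]
      have hpos : 0 < MvPolynomial.eval x (g.coeff n ^ (2 * k)) := by
        rw [map_pow, pow_mul]
        exact pow_pos (sq_pos_of_ne_zero hx) _
      rw [map_mul, hC, map_add, map_mul] at hdivx
      have := cauchyIndex_inv hf hg
      rw [← cauchyIndex_C_mul (spec x g) (spec x f) hpos, hdivx, cauchyIndex_add_mul,
        ← map_mul] at this
      rw [if_neg hf]
      exact eq_sub_of_add_eq this

/-- The Tarski query of `p` and `q`, restricted to the roots of `p` where a list of polynomials is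
positive. -/
noncomputable def tarskiQuery (L : List ℝ[X]) (p q : ℝ[X]) : ℤ :=
  open Classical in
  ∑ t ∈ p.roots.toFinset with ∀ s ∈ L, 0 < s.eval t, (SignType.sign (q.eval t) : ℤ)

lemma two_mul_tarskiQuery_cons (s : ℝ[X]) (L : List ℝ[X]) (p q : ℝ[X]) :
    2 * tarskiQuery (s :: L) p q = tarskiQuery L p (q * s) + tarskiQuery L p (q * s ^ 2) := by
  classical
  simp only [tarskiQuery, Finset.sum_filter, Finset.mul_sum, ← Finset.sum_add_distrib]
  refine Finset.sum_congr rfl fun t _ => ?_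
  simp only [List.forall_mem_cons, eval_mul, eval_pow, sign_mul, sign_pow]
  by_cases hL : ∀ s ∈ L, 0 < s.eval t
  · rw [if_pos hL, if_pos hL]
    by_cases h : 0 < s.eval t
    · rw [if_pos ⟨h, hL⟩, sign_pos h]
      simp [two_mul]
    · rw [if_neg fun h' => h h'.1]
      rcases (not_lt.1 h).lt_or_eq with h | h
      · simp [sign_neg h]
      · simp [h]
  · rw [if_neg hL, if_neg hL, if_neg fun h' => hL h'.2, mul_zero, add_zero]

lemma isTame_tarskiQuery (L : List (MvPolynomial ι ℝ)[X]) (p q : (MvPolynomial ι ℝ)[X]) :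
    IsTame fun x => tarskiQuery (L.map (spec x)) (spec x p) (spec x q) := by
  induction L generalizing q with
  | nil =>
    refine (isTame_cauchyIndex p (derivative p * q)).congr fun x => ?_
    have : spec x (derivative p) = derivative (spec x p) := (derivative_map _ _).symm
    rw [map_mul, this, cauchyIndex_derivative_mul]
    simp [tarskiQuery]
  | cons s L ih =>
    refine ((ih (q * s)).map₂ (ih (q * s ^ 2)) fun a b => (a + b) / 2).congr fun x => ?_
    rw [List.map_cons, map_mul, map_mul, map_pow, ← two_mul_tarskiQuery_cons]
    simp

lemma tarskiQuery_one_pos_iff {L : List ℝ[X]} {p : ℝ[X]} (hp : p ≠ 0) :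
    0 < tarskiQuery L p 1 ↔ ∃ t, p.eval t = 0 ∧ ∀ s ∈ L, 0 < s.eval t := by
  classical
  simp only [tarskiQuery, eval_one, sign_one, SignType.coe_one, Finset.sum_const, nsmul_eq_mul,
    mul_one, Nat.cast_pos, Finset.card_pos, Finset.Nonempty, Finset.mem_filter,
    Multiset.mem_toFinset, mem_roots hp, IsRoot.def]

lemma isSemialgPred_exists_root (L : List (MvPolynomial ι ℝ)[X]) (p : (MvPolynomial ι ℝ)[X]) :
    IsSemialgPred fun x => spec x p ≠ 0 ∧
      ∃ t, (spec x p).eval t = 0 ∧ ∀ s ∈ L, 0 < (spec x s).eval t := by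
  refine ((isSemialgPred_spec_eq_zero p).not.and
    ((isTame_tarskiQuery L p 1).pred fun k => 0 < k)).congr fun x => ?_
  refine and_congr_right fun hp => ?_
  rw [map_one, tarskiQuery_one_pos_iff hp]
  simp

lemma isSemialgPred_leadingCoeff_pos (p : (MvPolynomial ι ℝ)[X]) :
    IsSemialgPred fun x => 0 < (spec x p).leadingCoeff := by
  refine ((isTame_degree_sign (fun _ s => s) p).pred fun k => k = 1).congr fun x => ?_
  rw [← sign_eq_one_iff]
  generalize SignType.sign (spec x p).leadingCoeff = s
  cases s <;> decide

lemma isSemialgPred_exists_pos (L : List (MvPolynomial ι ℝ)[X]) :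
    IsSemialgPred fun x => ∃ t, ∀ s ∈ L, 0 < (spec x s).eval t := by
  refine ((IsSemialgPred.forall_list L fun s _ => isSemialgPred_leadingCoeff_pos s).or
    ((IsSemialgPred.forall_list L fun s _ => isSemialgPred_leadingCoeff_pos (s.comp (-X))).or
      (isSemialgPred_exists_root L (derivative L.prod)))).congr fun x => ?_
  have h := exists_pos_iff (L.map (spec x))
  have hcomp : ∀ s, spec x (s.comp (-X)) = (spec x s).comp (-X) := fun s => by
    simp [spec, Polynomial.map_comp]
  have hder : spec x (derivative L.prod) = derivative (L.map (spec x)).prod := by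
    rw [← map_list_prod]
    exact (derivative_map _ _).symm
  simpa only [List.forall_mem_map, hcomp, hder] using h

lemma isSemialgPred_exists_pos_and_zero (L E : List (MvPolynomial ι ℝ)[X]) :
    IsSemialgPred fun x => ∃ t, (∀ s ∈ L, 0 < (spec x s).eval t) ∧
      ∀ e ∈ E, (spec x e).eval t = 0 := by
  set p := (E.map fun e => e ^ 2).sum with hp
  have hsum : ∀ x t, (spec x p).eval t = 0 ↔ ∀ e ∈ E, (spec x e).eval t = 0 := by
    intro x t
    have : (spec x p).eval t = (E.map fun e => (spec x e).eval t ^ 2).sum := by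
      rw [hp, map_list_sum, ← coe_evalRingHom, map_list_sum]
      simp [Function.comp_def]
    rw [this]
    clear hp this p
    induction E with
    | nil => simp
    | cons e E ih =>
      have hnn : 0 ≤ (E.map fun e => (spec x e).eval t ^ 2).sum :=
        List.sum_nonneg fun a ha => by
          obtain ⟨e, -, rfl⟩ := List.mem_map.1 ha
          positivity
      rw [List.map_cons, List.sum_cons]
      refine (add_eq_zero_iff_of_nonneg (sq_nonneg _) hnn).trans ?_
      rw [List.forall_mem_cons]
      exact and_congr sq_eq_zero_iff ih
  refine (((isSemialgPred_spec_eq_zero p).and (isSemialgPred_exists_pos L)).or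
    (isSemialgPred_exists_root L p)).congr fun x => ?_
  simp only [← hsum, and_comm (a := ∀ s ∈ L, _)]
  by_cases h : spec x p = 0
  · simp [h]
  · simp [h]

end ParametricPolynomial

namespace IsSemialgPred

variable {ι κ : Type}

open ParametricPolynomial in
lemma exists_option {S : (Option ι → ℝ) → Prop} (hS : IsSemialgPred S) :
    IsSemialgPred fun x : ι → ℝ => ∃ t, S fun o => o.elim t x := by
  obtain ⟨p, hp⟩ := hS
  refine (exists_list p fun c _ => isSemialgPred_exists_pos_and_zero
    (c.1.map (MvPolynomial.optionEquivLeft ℝ ι))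
    (c.2.map (MvPolynomial.optionEquivLeft ℝ ι))).congr fun x => ?_
  have hev : ∀ t P, MvPolynomial.eval (fun o : Option ι => o.elim t x) P =
      (spec x (MvPolynomial.optionEquivLeft ℝ ι P)).eval t := fun t P =>
    MvPolynomial.optionEquivLeft_elim_eval _ _ x t P
  simp only [hp, hev, List.forall_mem_map]
  exact ⟨fun ⟨t, c, h1, h2⟩ => ⟨c, h1, t, h2⟩, fun ⟨c, h1, t, h2⟩ => ⟨t, c, h1, h2⟩⟩

/-- The Tarski–Seidenberg theorem, for the projection along finitely many coordinates. -/
lemma exists_sum {ν : Type} [Finite ν] {S : (ι ⊕ ν → ℝ) → Prop} (hS : IsSemialgPred S) :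
    IsSemialgPred fun x : ι → ℝ => ∃ w : ν → ℝ, S (Sum.elim x w) := by
  induction ν using Finite.induction_empty_option with
  | of_equiv e ih =>
    have := ih (hS.comp (φ := fun y => Sum.elim (fun i => y (.inl i)) fun a => y (.inr (e.symm a)))
      (by rintro (i | a) <;> exact .coord _))
    refine this.congr fun x => ?_
    refine (e.arrowCongr (Equiv.refl ℝ)).symm.exists_congr fun w => ?_
    simp [Function.comp_def]
  | h_empty =>
    refine (hS.comp (φ := fun y => Sum.elim y PEmpty.elim)
      (by rintro (i | a); exacts [.coord _, a.elim])).congr fun x => ?_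
    exact ⟨fun ⟨w, hw⟩ => by rwa [Subsingleton.elim PEmpty.elim w], fun h => ⟨_, h⟩⟩
  | @h_option ν _ ih =>
    have := ih (exists_option (hS.comp (κ := Option (ι ⊕ ν))
      (φ := fun y => Sum.elim (fun i => y (some (.inl i)))
        fun o => o.elim (y none) fun a => y (some (.inr a)))
      (by rintro (i | _ | a) <;> exact .coord _)))
    refine this.congr fun x => ⟨fun ⟨w, hw⟩ => ⟨fun a => w (some a), w none, ?_⟩,
      fun ⟨w, t, h⟩ => ⟨fun o => o.elim t w, h⟩⟩
    have : (fun o : Option ν => o.elim (w none) fun a => w (some a)) = w :=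
      funext fun o => by cases o <;> rfl
    change S (Sum.elim x fun o : Option ν => o.elim (w none) fun a => w (some a))
    rwa [this]

end IsSemialgPred

/-- A class of predicates on `ι → ℝ` is uniform if all its members are fibres of one semi-algebraic
predicate. -/
def IsUniform {ι : Type} (𝓢 : Set ((ι → ℝ) → Prop)) : Prop :=
  ∃ (κ : Type) (F : (κ ⊕ ι → ℝ) → Prop), IsSemialgPred F ∧
    ∀ S ∈ 𝓢, ∃ c : κ → ℝ, ∀ z, S z ↔ F (Sum.elim c z)

namespace IsUniform

variable {ι : Type} {𝓢 𝓣 𝓤 : Set ((ι → ℝ) → Prop)}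

lemma mono (h : IsUniform 𝓣) (hS : ∀ S ∈ 𝓢, ∃ T ∈ 𝓣, ∀ z, S z ↔ T z) : IsUniform 𝓢 := by
  obtain ⟨κ, F, hF, h⟩ := h
  refine ⟨κ, F, hF, fun S hS' => ?_⟩
  obtain ⟨T, hT, e⟩ := hS S hS'
  obtain ⟨c, hc⟩ := h T hT
  exact ⟨c, fun z => (e z).trans (hc z)⟩

lemma singleton {S : (ι → ℝ) → Prop} (hS : IsSemialgPred S) : IsUniform {S} := by
  refine ⟨Empty, _, hS.comp (φ := fun y i => y (.inr i)) fun i => .coord _, ?_⟩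
  rintro _ rfl
  exact ⟨Empty.elim, fun z => Iff.rfl⟩

lemma union (hS : IsUniform 𝓢) (hT : IsUniform 𝓣) : IsUniform (𝓢 ∪ 𝓣) := by
  obtain ⟨κ, F, hF, hS⟩ := hS
  obtain ⟨μ, G, hG, hT⟩ := hT
  have hF' := hF.comp (κ := Option (κ ⊕ μ) ⊕ ι)
    (φ := fun y => Sum.elim (fun a => y (.inl (some (.inl a)))) fun i => y (.inr i))
    (by rintro (a | i) <;> exact .coord _)
  have hG' := hG.comp (κ := Option (κ ⊕ μ) ⊕ ι)
    (φ := fun y => Sum.elim (fun a => y (.inl (some (.inr a)))) fun i => y (.inr i))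
    (by rintro (a | i) <;> exact .coord _)
  have h0 : IsSemialgPred fun y : Option (κ ⊕ μ) ⊕ ι → ℝ => y (.inl none) = 0 :=
    .eq_zero (.coord _)
  refine ⟨_, _, (h0.and hF').or (h0.not.and hG'), ?_⟩
  rintro S (hS' | hT')
  · obtain ⟨c, hc⟩ := hS S hS'
    exact ⟨fun o => o.elim 0 (Sum.elim c 0), fun z => by simp [hc]⟩
  · obtain ⟨c, hc⟩ := hT S hT'
    exact ⟨fun o => o.elim 1 (Sum.elim 0 c), fun z => by simp [hc]⟩

lemma and (hS : IsUniform 𝓢) (hT : IsUniform 𝓣)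
    (h : ∀ U ∈ 𝓤, ∃ S ∈ 𝓢, ∃ T ∈ 𝓣, ∀ z, U z ↔ S z ∧ T z) : IsUniform 𝓤 := by
  obtain ⟨κ, F, hF, hS⟩ := hS
  obtain ⟨μ, G, hG, hT⟩ := hT
  have hF' := hF.comp (κ := (κ ⊕ μ) ⊕ ι)
    (φ := fun y => Sum.elim (fun a => y (.inl (.inl a))) fun i => y (.inr i))
    (by rintro (a | i) <;> exact .coord _)
  have hG' := hG.comp (κ := (κ ⊕ μ) ⊕ ι)
    (φ := fun y => Sum.elim (fun a => y (.inl (.inr a))) fun i => y (.inr i))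
    (by rintro (a | i) <;> exact .coord _)
  refine ⟨_, _, hF'.and hG', fun U hU => ?_⟩
  obtain ⟨S, hS', T, hT', e⟩ := h U hU
  obtain ⟨c, hc⟩ := hS S hS'
  obtain ⟨c', hc'⟩ := hT T hT'
  exact ⟨Sum.elim c c', fun z => by simp [e, hc, hc']⟩

lemma not (hS : IsUniform 𝓢) (h : ∀ U ∈ 𝓤, ∃ S ∈ 𝓢, ∀ z, U z ↔ ¬ S z) : IsUniform 𝓤 := by
  obtain ⟨κ, F, hF, hS⟩ := hS
  refine ⟨κ, _, hF.not, fun U hU => ?_⟩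
  obtain ⟨S, hS', e⟩ := h U hU
  obtain ⟨c, hc⟩ := hS S hS'
  exact ⟨c, fun z => by rw [e, hc]⟩

lemma forall_list {α : Type} {w : α → ℕ} {Q : α → (ι → ℝ) → Prop}
    (h0 : ∀ a, w a = 0 → ∃ b : Prop, ∀ z, Q a z ↔ b)
    (h : ∀ D, IsUniform {S | ∃ a, w a ≤ D ∧ S = Q a}) (D : ℕ) :
    IsUniform {S | ∃ L : List α, (L.map w).sum ≤ D ∧ S = fun z => ∀ a ∈ L, Q a z} := by
  have trivial : IsUniform {S : (ι → ℝ) → Prop | ∃ b : Prop, ∀ z, S z ↔ b} := by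
    refine ((singleton .true).union (singleton .false)).mono ?_
    rintro S ⟨b, hb⟩
    by_cases h : b
    · exact ⟨_, Or.inl rfl, fun z => by simp [hb, h]⟩
    · exact ⟨_, Or.inr rfl, fun z => by simp [hb, h]⟩
  have const : ∀ L : List α, (∀ a ∈ L, w a = 0) → ∃ b : Prop, ∀ z, (∀ a ∈ L, Q a z) ↔ b := by
    intro L hL
    induction L with
    | nil => exact ⟨True, by simp⟩
    | cons a L ih =>
      obtain ⟨b, hb⟩ := h0 a (hL a (by simp))
      obtain ⟨b', hb'⟩ := ih fun a ha => hL a (by simp [ha])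
      exact ⟨b ∧ b', fun z => by rw [List.forall_mem_cons, hb, hb']⟩
  induction D with
  | zero =>
    refine trivial.mono ?_
    rintro _ ⟨L, hL, rfl⟩
    obtain ⟨b, hb⟩ := const L fun a ha =>
      Nat.le_zero.1 ((List.single_le_sum (by simp) _ (List.mem_map_of_mem ha)).trans hL)
    exact ⟨_, ⟨b, fun z => Iff.rfl⟩, hb⟩
  | succ D ih =>
    refine (trivial.union ((h (D + 1)).and ih (𝓤 := {U | ∃ a, w a ≤ D + 1 ∧ ∃ L : List α,
      (L.map w).sum ≤ D ∧ U = fun z => Q a z ∧ ∀ a ∈ L, Q a z}) ?_)).mono ?_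
    · rintro _ ⟨a, ha, L, hL, rfl⟩
      exact ⟨_, ⟨a, ha, rfl⟩, _, ⟨L, hL, rfl⟩, fun z => Iff.rfl⟩
    · rintro _ ⟨L, hL, rfl⟩
      by_cases hz : ∀ a ∈ L, w a = 0
      · obtain ⟨b, hb⟩ := const L hz
        exact ⟨_, Or.inl ⟨b, fun z => Iff.rfl⟩, hb⟩
      · push Not at hz
        obtain ⟨a, ha, hwa⟩ := hz
        obtain ⟨L₁, L₂, rfl⟩ := List.append_of_mem ha
        simp only [List.map_append, List.map_cons, List.sum_append, List.sum_cons] at hL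
        refine ⟨_, Or.inr ⟨a, by omega, L₁ ++ L₂, ?_, rfl⟩, fun z => ?_⟩
        · simp only [List.map_append, List.sum_append]; omega
        · simp only [List.forall_mem_append, List.forall_mem_cons]; tauto

end IsUniform

lemma exists_universal_polynomial (ι : Type) [Finite ι] (D : ℕ) :
    ∃ (κ : Type) (U : MvPolynomial (κ ⊕ ι) ℝ), ∀ P : MvPolynomial ι ℝ, P.totalDegree ≤ D →
      ∃ c : κ → ℝ, ∀ z, MvPolynomial.eval z P = MvPolynomial.eval (Sum.elim c z) U := by
  have := Fintype.ofFinite ι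
  have hfin : {m : ι →₀ ℕ | m.degree ≤ D}.Finite := Finsupp.finite_of_degree_le D
  refine ⟨ι →₀ ℕ, ∑ m ∈ hfin.toFinset, MvPolynomial.X (.inl m) *
    ∏ i, MvPolynomial.X (.inr i) ^ m i, fun P hP => ⟨fun m => P.coeff m, fun z => ?_⟩⟩
  rw [MvPolynomial.eval_eq']
  simp only [map_sum, map_mul, map_prod, map_pow, MvPolynomial.eval_X, Sum.elim_inl, Sum.elim_inr]
  refine Finset.sum_subset (fun m hm => ?_) fun m _ hm => ?_
  · simpa [Finsupp.degree_apply, Finsupp.sum] using (MvPolynomial.le_totalDegree hm).trans hP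
  · rw [MvPolynomial.notMem_support_iff.1 hm, zero_mul]

lemma eval_eq_of_totalDegree_eq_zero {ι : Type} {P : MvPolynomial ι ℝ} (hP : P.totalDegree = 0)
    (z : ι → ℝ) : MvPolynomial.eval z P = P.coeff 0 := by
  rw [MvPolynomial.totalDegree_eq_zero_iff_eq_C.1 hP]
  simp

lemma exists_universal_presentation (m D : ℕ) :
    IsUniform {S : (Fin m → ℝ) → Prop | ∃ p : SAPres m, p.deg ≤ D ∧ S = fun z => z ∈ p.toSet} := by
  have hpoly : ∀ r : ℝ → Prop, (∀ {ι : Type} (P : MvPolynomial ι ℝ),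
      IsSemialgPred fun z => r (MvPolynomial.eval z P)) → ∀ D,
      IsUniform {S : (Fin m → ℝ) → Prop | ∃ L : List (MvPolynomial (Fin m) ℝ),
        (L.map MvPolynomial.totalDegree).sum ≤ D ∧
          S = fun z => ∀ P ∈ L, r (MvPolynomial.eval z P)} := by
    intro r hr
    refine IsUniform.forall_list (fun P hP => ⟨r (P.coeff 0), fun z => ?_⟩) fun D => ?_
    · rw [eval_eq_of_totalDegree_eq_zero hP]
    · obtain ⟨κ, U, hU⟩ := exists_universal_polynomial (Fin m) D
      refine ⟨κ, _, hr U, ?_⟩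
      rintro _ ⟨P, hP, rfl⟩
      obtain ⟨c, hc⟩ := hU P hP
      exact ⟨c, fun z => by simp only [hc]⟩
  have hclause := IsUniform.forall_list (ι := Fin m)
    (w := fun c : List (MvPolynomial (Fin m) ℝ) × List (MvPolynomial (Fin m) ℝ) =>
      (c.1.map MvPolynomial.totalDegree).sum + (c.2.map MvPolynomial.totalDegree).sum)
    (Q := fun c z => ¬ ((∀ P ∈ c.1, 0 < MvPolynomial.eval z P) ∧
      ∀ P ∈ c.2, MvPolynomial.eval z P = 0)) (fun c hc => ?_) (fun D => ?_) D
  · refine hclause.not ?_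
    rintro _ ⟨p, hp, rfl⟩
    refine ⟨_, ⟨p, hp, rfl⟩, fun z => ?_⟩
    simp only [not_forall, exists_prop, not_not]
    rfl
  · have hdeg : ∀ L : List (MvPolynomial (Fin m) ℝ), (L.map MvPolynomial.totalDegree).sum = 0 →
        ∀ P ∈ L, P.totalDegree = 0 := fun L hL P hP =>
      Nat.le_zero.1 ((List.single_le_sum (by simp) _ (List.mem_map_of_mem hP)).trans hL.le)
    refine ⟨¬ ((∀ P ∈ c.1, 0 < P.coeff 0) ∧ ∀ P ∈ c.2, P.coeff 0 = 0), fun z => not_congr ?_⟩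
    refine and_congr (forall₂_congr fun P hP => ?_) (forall₂_congr fun P hP => ?_)
    · rw [eval_eq_of_totalDegree_eq_zero (hdeg c.1 (by omega) P hP)]
    · rw [eval_eq_of_totalDegree_eq_zero (hdeg c.2 (by omega) P hP)]
  · refine ((hpoly (fun t => 0 < t) (fun P => .pos (.eval P)) D).and
      (hpoly (fun t => t = 0) (fun P => .eq_zero (.eval P)) D) (𝓤 := {U | ∃ c : List
        (MvPolynomial (Fin m) ℝ) × List (MvPolynomial (Fin m) ℝ),
        (c.1.map MvPolynomial.totalDegree).sum + (c.2.map MvPolynomial.totalDegree).sum ≤ D ∧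
        U = fun z => (∀ P ∈ c.1, 0 < MvPolynomial.eval z P) ∧
          ∀ P ∈ c.2, MvPolynomial.eval z P = 0}) ?_).not ?_
    · rintro _ ⟨c, hc, rfl⟩
      exact ⟨_, ⟨c.1, by omega, rfl⟩, _, ⟨c.2, by omega, rfl⟩, fun z => Iff.rfl⟩
    · rintro _ ⟨c, hc, rfl⟩
      exact ⟨_, ⟨c, hc, rfl⟩, fun z => Iff.rfl⟩

/-- All semi-algebraic sets of bounded degree are fibres of one semi-algebraic predicate. -/
lemma exists_universal_predicate (m D : ℕ) :
    ∃ (κ : Type) (F : (κ ⊕ Fin m → ℝ) → Prop), IsSemialgPred F ∧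
      ∀ A : Set (Fin m → ℝ), IsSemialgebraic A → SADeg A ≤ D →
        ∃ c : κ → ℝ, ∀ z, z ∈ A ↔ F (Sum.elim c z) := by
  obtain ⟨κ, F, hF, h⟩ := exists_universal_presentation m D
  refine ⟨κ, F, hF, fun A ⟨q, hq⟩ hD => ?_⟩
  obtain ⟨p, hp, hpD⟩ := Nat.sInf_mem (s := SAPres.deg '' {p : SAPres m | p.toSet = A})
    ⟨_, q, hq, rfl⟩
  obtain rfl : p.toSet = A := hp
  exact h _ ⟨p, hpD.trans_le hD, rfl⟩

lemma exists_totalDegree_specialization_le {κ ι : Type} (P : MvPolynomial (κ ⊕ ι) ℝ) :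
    ∃ B, ∀ c : κ → ℝ, (MvPolynomial.bind₁ (Sum.elim (fun a => MvPolynomial.C (c a))
      MvPolynomial.X) P : MvPolynomial ι ℝ).totalDegree ≤ B := by
  induction P using MvPolynomial.induction_on with
  | C a => exact ⟨0, fun c => by simp⟩
  | add p q hp hq =>
    obtain ⟨B, hB⟩ := hp
    obtain ⟨B', hB'⟩ := hq
    refine ⟨max B B', fun c => ?_⟩
    rw [map_add]
    exact (MvPolynomial.totalDegree_add _ _).trans (max_le_max (hB c) (hB' c))
  | mul_X p i hp =>
    obtain ⟨B, hB⟩ := hp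
    refine ⟨B + 1, fun c => ?_⟩
    rw [map_mul, MvPolynomial.bind₁_X_right]
    refine (MvPolynomial.totalDegree_mul _ _).trans (add_le_add (hB c) ?_)
    cases i <;> simp

lemma exists_map_sum_le {α κ : Type} (L : List α) (w : κ → α → ℕ) (h : ∀ a, ∃ B, ∀ c, w c a ≤ B) :
    ∃ B, ∀ c, (L.map (w c)).sum ≤ B := by
  choose B hB using h
  exact ⟨(L.map B).sum, fun c => List.sum_le_sum fun a _ => hB a c⟩

/-- The fibres of a semi-algebraic predicate are semi-algebraic sets of bounded degree. -/
lemma exists_sadeg_fibre_le {κ : Type} {m : ℕ} {F : (κ ⊕ Fin m → ℝ) → Prop}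
    (hF : IsSemialgPred F) : ∃ B, ∀ (A : Set (Fin m → ℝ)) (c : κ → ℝ),
      (∀ z, z ∈ A ↔ F (Sum.elim c z)) → IsSemialgebraic A ∧ SADeg A ≤ B := by
  obtain ⟨p, hp⟩ := hF
  let σ (c : κ → ℝ) : MvPolynomial (κ ⊕ Fin m) ℝ → MvPolynomial (Fin m) ℝ :=
    MvPolynomial.bind₁ (Sum.elim (fun a => MvPolynomial.C (c a)) MvPolynomial.X)
  have hσ : ∀ c z P, MvPolynomial.eval z (σ c P) = MvPolynomial.eval (Sum.elim c z) P := by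
    intro c z P
    rw [← MvPolynomial.coe_aeval_eq_eval, ← MvPolynomial.coe_aeval_eq_eval]
    simp only [RingHom.coe_coe, σ, MvPolynomial.aeval_bind₁]
    congr 2
    funext i
    cases i <;> simp
  obtain ⟨B, hB⟩ := exists_map_sum_le p
    (fun c a => (a.1.map fun P => (σ c P).totalDegree).sum +
      (a.2.map fun P => (σ c P).totalDegree).sum) fun a => by
    obtain ⟨B, hB⟩ := exists_map_sum_le a.1 (fun c P => (σ c P).totalDegree)
      exists_totalDegree_specialization_le
    obtain ⟨B', hB'⟩ := exists_map_sum_le a.2 (fun c P => (σ c P).totalDegree)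
      exists_totalDegree_specialization_le
    exact ⟨B + B', fun c => add_le_add (hB c) (hB' c)⟩
  refine ⟨B, fun A c hA => ?_⟩
  let q : SAPres m := p.map fun a => (a.1.map (σ c), a.2.map (σ c))
  have hq : q.toSet = A := by
    ext z
    rw [hA, hp]
    simp [SAPres.toSet, q, hσ]
  have hqd : q.deg ∈ SAPres.deg '' {p : SAPres m | p.toSet = A} := ⟨q, hq, rfl⟩
  refine ⟨⟨q, hq⟩, (Nat.sInf_le hqd).trans ((le_of_eq ?_).trans (hB c))⟩
  simp [SAPres.deg, q, Function.comp_def]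

namespace IsSemialgPred

variable {ι ν : Type}

lemma exists_real {S : ℝ → (ι → ℝ) → Prop}
    (hS : IsSemialgPred fun y : Option ι → ℝ => S (y none) fun i => y (some i)) :
    IsSemialgPred fun x => ∃ t, S t x :=
  exists_option hS

lemma forall_real {S : ℝ → (ι → ℝ) → Prop}
    (hS : IsSemialgPred fun y : Option ι → ℝ => S (y none) fun i => y (some i)) :
    IsSemialgPred fun x => ∀ t, S t x :=
  (exists_real (S := fun t x => ¬ S t x) hS.not).not.congr fun _ => by simp

lemma exists_vector [Finite ν] {S : (ν → ℝ) → (ι → ℝ) → Prop}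
    (hS : IsSemialgPred fun y : ι ⊕ ν → ℝ => S (fun j => y (.inr j)) fun i => y (.inl i)) :
    IsSemialgPred fun x => ∃ v, S v x :=
  exists_sum hS

lemma forall_vector [Finite ν] {S : (ν → ℝ) → (ι → ℝ) → Prop}
    (hS : IsSemialgPred fun y : ι ⊕ ν → ℝ => S (fun j => y (.inr j)) fun i => y (.inl i)) :
    IsSemialgPred fun x => ∀ v, S v x :=
  (exists_vector (S := fun v x => ¬ S v x) hS.not).not.congr fun _ => by simp

end IsSemialgPred

/-- A first-order expression of `w = ∂ᵢ f x`, where `Γ` is the graph of `f`. -/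
def IsPartialDeriv {d n : ℕ} (Γ : (Fin (d + n) → ℝ) → Prop) (i : Fin d) (x : Fin d → ℝ)
    (w : Fin n → ℝ) : Prop :=
  (∃ v : Fin n → ℝ, Γ (Fin.append x v)) ∧
    ∀ ε : ℝ, 0 < ε → ∃ δ : ℝ, 0 < δ ∧ ∀ t : ℝ, -δ < t → t < δ → ∀ v v' : Fin n → ℝ,
      Γ (Fin.append x v) → Γ (Fin.append (fun a => x a + t * (Pi.single i 1 : Fin d → ℝ) a) v') →
        ∀ j, (v' j - v j - t * w j) * (v' j - v j - t * w j) ≤ (ε * t) * (ε * t)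

lemma isPolyFun_append {ι : Type} {d n : ℕ} {x : (ι → ℝ) → Fin d → ℝ} {v : (ι → ℝ) → Fin n → ℝ}
    (hx : ∀ a, IsPolyFun fun y => x y a) (hv : ∀ a, IsPolyFun fun y => v y a) (a : Fin (d + n)) :
    IsPolyFun fun y => Fin.append (x y) (v y) a := by
  induction a using Fin.addCases with
  | left a => simpa using hx a
  | right a => simpa using hv a

lemma IsSemialgPred.isPartialDeriv {κ : Type} {d n : ℕ} {F : (κ ⊕ Fin (d + n) → ℝ) → Prop}
    (hF : IsSemialgPred F) (i : Fin d) : IsSemialgPred fun y : κ ⊕ Fin (d + n) → ℝ =>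
      IsPartialDeriv (fun z => F (Sum.elim (fun a => y (.inl a)) z)) i
        (fun a => y (.inr (Fin.castAdd n a))) fun j => y (.inr (Fin.natAdd d j)) := by
  have hF' : ∀ {ι : Type} {c : (ι → ℝ) → κ → ℝ} {x : (ι → ℝ) → Fin d → ℝ}
      {v : (ι → ℝ) → Fin n → ℝ}, (∀ a, IsPolyFun fun y => c y a) →
      (∀ a, IsPolyFun fun y => x y a) → (∀ a, IsPolyFun fun y => v y a) →
      IsSemialgPred fun y => F (Sum.elim (c y) (Fin.append (x y) (v y))) := by
    intro ι c x v hc hx hv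
    refine hF.comp ?_
    rintro (a | a)
    · exact hc a
    · exact isPolyFun_append hx hv a
  refine .and (.exists_vector (hF' ?_ ?_ ?_)) ?_
  rotate_left 3
  · refine .forall_real (.imp (.pos ?_) (.exists_real (.and (.pos ?_) (.forall_real
      (.imp (.lt (.neg ?_) ?_) (.imp (.lt ?_ ?_) (.forall_vector (.forall_vector
        (.imp (hF' ?_ ?_ ?_) (.imp (hF' ?_ ?_ ?_) (.forall_finite fun j => ?_)))))))))))
    rotate_right
    · have h {ι : Type} (a b c e : ι) : IsPolyFun fun y : ι → ℝ => y a - y b - y c * y e :=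
        ((IsPolyFun.coord _).sub (.coord _)).sub ((IsPolyFun.coord _).mul (.coord _))
      exact .le (.mul (h _ _ _ _) (h _ _ _ _))
        (.mul (.mul (.coord _) (.coord _)) (.mul (.coord _) (.coord _)))
    all_goals first
      | exact .coord _
      | exact fun _ => .coord _
      | exact fun _ => (IsPolyFun.coord _).add ((IsPolyFun.coord _).mul (.const _))
  all_goals exact fun _ => .coord _

open Topology in
lemma forall_hasDerivAt_iff {n : ℕ} {h : Fin n → ℝ → ℝ} {P : ℝ → Prop} (hP : ∀ᶠ t in 𝓝 0, P t)
    (w : Fin n → ℝ) : (∀ ε : ℝ, 0 < ε → ∃ δ : ℝ, 0 < δ ∧ ∀ t : ℝ, -δ < t → t < δ → P t → ∀ j,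
      (h j t - h j 0 - t * w j) * (h j t - h j 0 - t * w j) ≤ (ε * t) * (ε * t)) ↔
      ∀ j, HasDerivAt (h j) (w j) 0 := by
  have key : (∀ j, HasDerivAt (h j) (w j) 0) ↔
      ∀ ε : ℝ, 0 < ε → ∀ᶠ t in 𝓝 0, P t → ∀ j,
      (h j t - h j 0 - t * w j) * (h j t - h j 0 - t * w j) ≤ (ε * t) * (ε * t) := by
    simp only [hasDerivAt_iff_isLittleO_nhds_zero, Asymptotics.isLittleO_iff, zero_add, smul_eq_mul]
    rw [forall_comm]
    refine forall_congr' fun ε => ?_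
    rw [forall_comm]
    refine forall_congr' fun hε => ?_
    rw [← Filter.eventually_all]
    have e : ∀ t j, ‖h j t - h j 0 - t * w j‖ ≤ ε * ‖t‖ ↔
        (h j t - h j 0 - t * w j) * (h j t - h j 0 - t * w j) ≤ (ε * t) * (ε * t) := by
      intro t j
      rw [← abs_le_iff_mul_self_le, abs_mul, abs_of_pos hε, Real.norm_eq_abs, Real.norm_eq_abs]
    simp only [e]
    exact ⟨fun H => H.mono fun t ht _ => ht, fun H => (H.and hP).mono fun t ht => ht.1 ht.2⟩
  rw [key]
  refine forall₂_congr fun ε _ => ?_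
  rw [Metric.eventually_nhds_iff]
  refine exists_congr fun δ => and_congr_right fun _ => ?_
  simp only [dist_zero_right, Real.norm_eq_abs, abs_lt, and_imp]

lemma append_mem_graphSet {d n : ℕ} {A : Set (Fin d → ℝ)} {f : (Fin d → ℝ) → Fin n → ℝ}
    {x : Fin d → ℝ} {v : Fin n → ℝ} : Fin.append x v ∈ graphSet A f ↔ x ∈ A ∧ v = f x := by
  simp [graphSet]

lemma hasDerivAt_pderiv1 {d : ℕ} {f : (Fin d → ℝ) → ℝ} {x : Fin d → ℝ}
    (hf : DifferentiableAt ℝ f x) (i : Fin d) :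
    HasDerivAt (fun t : ℝ => f fun a => x a + t * (Pi.single i 1 : Fin d → ℝ) a) (pderiv1 i f x) 0 := by
  have h : HasLineDerivAt ℝ f (pderiv1 i f x) x (Pi.single i 1) :=
    hf.hasFDerivAt.hasLineDerivAt _
  exact h

open Topology in
lemma isPartialDeriv_graphSet_iff {d n : ℕ} {A : Set (Fin d → ℝ)} {f : (Fin d → ℝ) → Fin n → ℝ}
    (hA : IsOpen A) (hf : ∀ x ∈ A, ∀ j, DifferentiableAt ℝ (fun y => f y j) x) (i : Fin d)
    (x : Fin d → ℝ) (w : Fin n → ℝ) :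
    IsPartialDeriv (fun z => z ∈ graphSet A f) i x w ↔
      x ∈ A ∧ w = fun j => pderiv1 i (fun y => f y j) x := by
  simp only [IsPartialDeriv, append_mem_graphSet, exists_and_left, exists_eq, and_true]
  refine and_congr_right fun hx => ?_
  set ℓ : ℝ → Fin d → ℝ := fun t a => x a + t * (Pi.single i 1 : Fin d → ℝ) a with hℓ
  have hℓ0 : ℓ 0 = x := by simp [hℓ]
  have hcont : Continuous ℓ := by fun_prop
  have hP : ∀ᶠ t in 𝓝 0, ℓ t ∈ A :=
    hcont.continuousAt.eventually_mem (by rw [hℓ0]; exact hA.mem_nhds hx)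
  have key := forall_hasDerivAt_iff (h := fun j t => f (ℓ t) j) hP w
  rw [hℓ0] at key
  have hder := fun j => hasDerivAt_pderiv1 (hf x hx j) i
  refine Iff.trans ?_ (key.trans ⟨fun H => funext fun j => (H j).unique (hder j), ?_⟩)
  · simp only [hx, true_and, and_imp]
    refine forall₂_congr fun ε _ => exists_congr fun δ => and_congr_right fun _ =>
      forall₃_congr fun t _ _ => ⟨fun H hm => H _ _ rfl hm rfl, ?_⟩
    rintro H v v' rfl hm rfl
    exact H hm
  · rintro rfl
    exact hder

lemma exists_pderiv1_degree_bound (D d n : ℕ) (i : Fin d) : ∃ B, ∀ (A : Set (Fin d → ℝ))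
    (f : (Fin d → ℝ) → Fin n → ℝ), IsOpen A →
    (∀ x ∈ A, ∀ j, DifferentiableAt ℝ (fun y => f y j) x) → IsSAMap A f → SAMapDeg A f ≤ D →
    IsSAMap A (fun x j => pderiv1 i (fun y => f y j) x) ∧
      SAMapDeg A (fun x j => pderiv1 i (fun y => f y j) x) ≤ B := by
  obtain ⟨κ, F, hF, huniv⟩ := exists_universal_predicate (d + n) D
  obtain ⟨B, hB⟩ := exists_sadeg_fibre_le (hF.isPartialDeriv i)
  refine ⟨B, fun A f hA hf hSA hD => ?_⟩
  obtain ⟨c, hc⟩ := huniv _ hSA hD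
  refine hB _ c fun z => ?_
  simp only [Sum.elim_inl, Sum.elim_inr, ← hc]
  exact (isPartialDeriv_graphSet_iff hA hf i _ _).symm

/-- One partial derivative keeps the degree of a semi-algebraic map under uniform control. -/
lemma exists_uniform_pderiv1_degree_bound : ∃ B : ℕ → ℕ → ℕ → ℕ, ∀ (d n D : ℕ)
    (A : Set (Fin d → ℝ)) (f : (Fin d → ℝ) → Fin n → ℝ), IsOpen A →
    (∀ x ∈ A, ∀ j, DifferentiableAt ℝ (fun y => f y j) x) → IsSAMap A f → SAMapDeg A f ≤ D →
    ∀ i, IsSAMap A (fun x j => pderiv1 i (fun y => f y j) x) ∧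
      SAMapDeg A (fun x j => pderiv1 i (fun y => f y j) x) ≤ B d n D := by
  choose B hB using exists_pderiv1_degree_bound
  refine ⟨fun d n D => ∑ i, B D d n i, fun d n D A f hA hf hSA hD i => ?_⟩
  obtain ⟨h, h'⟩ := hB D d n i A f hA hf hSA hD
  exact ⟨h, h'.trans (Finset.single_le_sum (f := B D d n) (fun _ _ => Nat.zero_le _)
    (Finset.mem_univ i))⟩

lemma analyticAt_pderiv1 {d : ℕ} {f : (Fin d → ℝ) → ℝ} {x : Fin d → ℝ} (hf : AnalyticAt ℝ f x)
    (i : Fin d) : AnalyticAt ℝ (pderiv1 i f) x :=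
  ((ContinuousLinearMap.apply ℝ ℝ (Pi.single i 1 : Fin d → ℝ)).analyticAt _).comp hf.fderiv

lemma IsNashMap.analyticAt {d n : ℕ} {A : Set (Fin d → ℝ)} {f : (Fin d → ℝ) → Fin n → ℝ}
    (hA : IsOpen A) (hf : IsNashMap A f) {x : Fin d → ℝ} (hx : x ∈ A) (j : Fin n) :
    AnalyticAt ℝ (fun y => f y j) x := by
  obtain ⟨U, g, hU, hxU, hg, hfg⟩ := hf.2 x hx
  refine (((ContinuousLinearMap.proj (R := ℝ) (φ := fun _ : Fin n => ℝ) j).analyticAt _).comp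
    (hg x hxU)).congr ?_
  filter_upwards [(hA.inter hU).mem_nhds ⟨hx, hxU⟩] with y hy
  exact congrFun (hfg hy).symm j

/-- Partial derivatives along a list of directions, applied from left to right. -/
noncomputable def iterPderiv {d : ℕ} (l : List (Fin d)) (f : (Fin d → ℝ) → ℝ) : (Fin d → ℝ) → ℝ :=
  l.foldl (fun g i => pderiv1 i g) f

lemma mpderiv_eq_iterPderiv {d : ℕ} (β : Fin d → ℕ) : ∃ l : List (Fin d), l.length = mIdxDeg β ∧
    ∀ f, mpderiv β f = iterPderiv l f := by
  refine ⟨(List.finRange d).flatMap fun i => List.replicate (β i) i, ?_, fun f => ?_⟩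
  · simp [List.length_flatMap, mIdxDeg, Fin.sum_univ_def]
  · rw [iterPderiv, List.foldl_flatMap, mpderiv]
    congr 1
    funext g i
    generalize β i = k
    induction k generalizing g with
    | zero => rfl
    | succ k ih => rw [Function.iterate_succ_apply, ih]; rfl

lemma iterPderiv_degree_bound {B : ℕ → ℕ} {d n : ℕ} {A : Set (Fin d → ℝ)}
    (hB : ∀ (D : ℕ) (f : (Fin d → ℝ) → Fin n → ℝ),
      (∀ x ∈ A, ∀ j, DifferentiableAt ℝ (fun y => f y j) x) → IsSAMap A f → SAMapDeg A f ≤ D →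
      ∀ i, IsSAMap A (fun x j => pderiv1 i (fun y => f y j) x) ∧
        SAMapDeg A (fun x j => pderiv1 i (fun y => f y j) x) ≤ B D)
    (l : List (Fin d)) (D : ℕ) (f : (Fin d → ℝ) → Fin n → ℝ)
    (hf : ∀ x ∈ A, ∀ j, AnalyticAt ℝ (fun y => f y j) x) (hSA : IsSAMap A f)
    (hD : SAMapDeg A f ≤ D) :
    IsSAMap A (fun x j => iterPderiv l (fun y => f y j) x) ∧
      SAMapDeg A (fun x j => iterPderiv l (fun y => f y j) x) ≤ B^[l.length] D := by
  induction l generalizing D f with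
  | nil => exact ⟨hSA, hD⟩
  | cons i l ih =>
    obtain ⟨h, h'⟩ := hB D f (fun x hx j => (hf x hx j).differentiableAt) hSA hD i
    exact ih (B D) (fun x j => pderiv1 i (fun y => f y j) x)
      (fun x hx j => analyticAt_pderiv1 (hf x hx j) i) h h'

/-- Partial derivatives (of all orders) of a Nash map on an open semi-algebraic set are
semi-algebraic maps, of degree bounded by a function of `deg f`, the order of derivation,
and the ambient dimensions only. -/
theorem nash_partial_derivatives_semialgebraic :
    ∃ C : ℕ → ℕ → ℕ → ℕ → ℕ,
      ∀ (d n : ℕ) (A : Set (Fin d → ℝ)) (f : (Fin d → ℝ) → (Fin n → ℝ)),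
        IsOpen A → IsSemialgebraic A → IsNashMap A f →
        ∀ β : Fin d → ℕ,
          IsSAMap A (fun x (j : Fin n) => mpderiv β (fun y => f y j) x) ∧
          SAMapDeg A (fun x (j : Fin n) => mpderiv β (fun y => f y j) x) ≤
            C (SAMapDeg A f) (mIdxDeg β) d n := by
  obtain ⟨B, hB⟩ := exists_uniform_pderiv1_degree_bound
  refine ⟨fun D k d n => (B d n)^[k] D, fun d n A f hA _ hf β => ?_⟩
  obtain ⟨l, hl, hβ⟩ := mpderiv_eq_iterPderiv β
  simp only [hβ, ← hl]
  exact iterPderiv_degree_bound (fun D f => hB d n D A f hA) l _ f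
    (fun x hx j => hf.analyticAt hA hx j) hf.1 le_rfl
end

section
/- Let (A_n)_{n ∈ ℕ} be a sequence of subsets of (0,1)^l satisfying sup_{x ∈ (0,1)^l} d(x, A_n) → 0 as n → ∞, and let φ : (0,1)^l → (0,1)^d be a continuous map (not necessarily uniformly continuous). Then sup_{x ∈ φ((0,1)^l)} d(x, φ(A_n)) → 0 as n → ∞. -/
open Set

/-- If `s` has totally bounded image under `f`, and the sets `A n ⊆ s` become dense in `s`
pointwise, then the images `f '' A n` become dense in `f '' s` uniformly. -/
theorem eventually_infDist_image_le {X Y : Type*} [PseudoMetricSpace X] [PseudoMetricSpace Y]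
    {f : X → Y} {s : Set X} {A : ℕ → Set X} (hA : ∀ n, A n ⊆ s) (hf : ContinuousOn f s)
    (hb : TotallyBounded (f '' s))
    (hconv : ∀ x ∈ s, Filter.Tendsto (fun n => Metric.infDist x (A n)) Filter.atTop (nhds 0))
    {ε : ℝ} (hε : 0 < ε) :
    ∀ᶠ n in Filter.atTop, ∀ y ∈ f '' s, Metric.infDist y (f '' A n) ≤ ε := by
  obtain ⟨t, hts, htf, hcov⟩ := Metric.finite_approx_of_totallyBounded hb (ε / 2) (half_pos hε)
  have key : ∀ z ∈ t, ∀ᶠ n in Filter.atTop,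
      (A n).Nonempty → ∃ a ∈ A n, dist (f a) z < ε / 2 := by
    intro z hz
    obtain ⟨x, hx, rfl⟩ := hts hz
    obtain ⟨δ, hδ, hδf⟩ := Metric.continuousOn_iff.1 hf x hx (ε / 2) (half_pos hε)
    filter_upwards [(hconv x hx).eventually_lt_const hδ] with n hn hne
    obtain ⟨a, ha, hxa⟩ := (Metric.infDist_lt_iff hne).1 hn
    exact ⟨a, ha, hδf a (hA n ha) (by rwa [dist_comm])⟩
  filter_upwards [(Filter.eventually_all_finite htf).2 key] with n hn y hy
  rcases (A n).eq_empty_or_nonempty with h | hne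
  · simp [h, hε.le]
  · obtain ⟨z, hz, hyz⟩ := mem_iUnion₂.1 (hcov hy)
    obtain ⟨a, ha, haz⟩ := hn z hz hne
    calc Metric.infDist y (f '' A n) ≤ dist y (f a) :=
          Metric.infDist_le_dist_of_mem (mem_image_of_mem f ha)
      _ ≤ dist y z + dist (f a) z := dist_triangle_right _ _ _
      _ ≤ ε := by linarith [Metric.mem_ball.1 hyz]

theorem eDist_eq_infDist {d : ℕ} (x : Fin d → ℝ) (S : Set (Fin d → ℝ)) :
    eDist x S = Metric.infDist (WithLp.toLp 2 x) (WithLp.toLp 2 '' S) := by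
  rw [Metric.infDist_eq_iInf, ← sInf_image', image_image, eDist]
  simp [EuclideanSpace.dist_eq, Real.dist_eq]

theorem totallyBounded_toLp_image_cubeO (d : ℕ) :
    TotallyBounded (WithLp.toLp 2 '' cubeO d : Set (EuclideanSpace ℝ (Fin d))) := by
  have hc : IsCompact (Icc (0 : Fin d → ℝ) 1) := isCompact_Icc
  refine (hc.image (PiLp.continuous_toLp 2 _)).totallyBounded.subset (image_mono fun x hx => ?_)
  exact ⟨fun i => (hx i).1.le, fun i => (hx i).2.le⟩

theorem eDist_nonneg {d : ℕ} (x : Fin d → ℝ) (S : Set (Fin d → ℝ)) : 0 ≤ eDist x S := by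
  rw [eDist_eq_infDist]
  exact Metric.infDist_nonneg

theorem eDist_le_iSup_cubeO {d : ℕ} {S : Set (Fin d → ℝ)} (hS : S ⊆ cubeO d) {x : Fin d → ℝ}
    (hx : x ∈ cubeO d) : eDist x S ≤ ⨆ x ∈ cubeO d, eDist x S := by
  have hb : BddAbove (range fun y => ⨆ _ : y ∈ cubeO d, eDist y S) := by
    refine ⟨Metric.diam (WithLp.toLp 2 '' cubeO d : Set (EuclideanSpace ℝ (Fin d))), ?_⟩
    rintro _ ⟨y, rfl⟩
    refine Real.iSup_le (fun hy => ?_) Metric.diam_nonneg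
    rw [eDist_eq_infDist]
    rcases S.eq_empty_or_nonempty with rfl | ⟨a, ha⟩
    · simpa using Metric.diam_nonneg
    · exact (Metric.infDist_le_dist_of_mem (mem_image_of_mem _ ha)).trans
        (Metric.dist_le_diam_of_mem (totallyBounded_toLp_image_cubeO d).isBounded
          (mem_image_of_mem _ hy) (mem_image_of_mem _ (hS ha)))
  simpa [hx] using le_ciSup hb x


/-- If `(Aₙ)` are subsets of `(0,1)^l` with `sup_{x ∈ (0,1)^l} d(x, Aₙ) → 0` and
`φ : (0,1)^l → (0,1)^d` is continuous, then `sup_{x ∈ φ((0,1)^l)} d(x, φ(Aₙ)) → 0`. -/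
theorem image_of_dense_sequence {l d : ℕ} (An : ℕ → Set (Fin l → ℝ))
    (φ : (Fin l → ℝ) → (Fin d → ℝ))
    (hAn : ∀ n, An n ⊆ cubeO l)
    (hconv : Filter.Tendsto (fun n => ⨆ x ∈ cubeO l, eDist x (An n)) Filter.atTop (nhds 0))
    (hφ : ContinuousOn φ (cubeO l))
    (hmaps : ∀ x ∈ cubeO l, φ x ∈ cubeO d) :
    Filter.Tendsto (fun n => ⨆ x ∈ φ '' cubeO l, eDist x (φ '' An n))
      Filter.atTop (nhds 0) := by
  let f : EuclideanSpace ℝ (Fin l) → EuclideanSpace ℝ (Fin d) := fun x => WithLp.toLp 2 (φ x.ofLp)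
  have hfimage (S : Set (Fin l → ℝ)) : f '' (WithLp.toLp 2 '' S) = WithLp.toLp 2 '' (φ '' S) := by
    simp only [image_image, f]
  have hf : ContinuousOn f (WithLp.toLp 2 '' cubeO l) := by
    refine (PiLp.continuous_toLp 2 _).comp_continuousOn
      (hφ.comp (PiLp.continuous_ofLp 2 _).continuousOn ?_)
    rintro _ ⟨x, hx, rfl⟩
    exact hx
  have hb : TotallyBounded (f '' (WithLp.toLp 2 '' cubeO l)) := by
    rw [hfimage]
    exact (totallyBounded_toLp_image_cubeO d).subset (image_mono (mapsTo_iff_image_subset.1 hmaps))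
  have hpt : ∀ x ∈ (WithLp.toLp 2 '' cubeO l : Set (EuclideanSpace ℝ (Fin l))),
      Filter.Tendsto (fun n => Metric.infDist x (WithLp.toLp 2 '' An n))
        Filter.atTop (nhds 0) := by
    rintro _ ⟨x, hx, rfl⟩
    simp only [← eDist_eq_infDist]
    exact squeeze_zero (fun n => eDist_nonneg _ _) (fun n => eDist_le_iSup_cubeO (hAn n) hx) hconv
  rw [Metric.tendsto_nhds]
  intro ε hε
  filter_upwards [eventually_infDist_image_le (fun n => image_mono (hAn n)) hf hb hpt
    (half_pos hε)] with n hn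
  rw [hfimage, hfimage] at hn
  have hnonneg : 0 ≤ ⨆ x ∈ φ '' cubeO l, eDist x (φ '' An n) :=
    Real.iSup_nonneg fun _ => Real.iSup_nonneg fun _ => eDist_nonneg _ _
  rw [Real.dist_0_eq_abs, abs_of_nonneg hnonneg]
  refine (Real.iSup_le (fun y => Real.iSup_le (fun hy => ?_) (half_pos hε).le)
    (half_pos hε).le).trans_lt (half_lt_self hε)
  rw [eDist_eq_infDist]
  exact hn _ (mem_image_of_mem _ hy)
end

section
/- Let r ≥ 0 be an integer and let f : (0,1) → ℝ be (r+1) times differentiable with |f^{(r)}(x)| ≤ 1 for all x ∈ (0,1), such that f^{(r+1)} has constant sign on (0,1) and |f^{(r+1)}| is decreasing on (0,1). Then for all x ∈ (0,1), x · |f^{(r+1)}(x)| ≤ 2. -/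
open Set

/-- If `g` is differentiable and bounded by `C` on `(a, b)` and `|g'|` is non-increasing there,
then `(x - a) * |g' x| ≤ 2 * C`. -/
theorem sub_mul_abs_deriv_le_two_mul {g : ℝ → ℝ} {a b C : ℝ}
    (hg : ∀ x ∈ Ioo a b, DifferentiableAt ℝ g x) (hC : ∀ x ∈ Ioo a b, |g x| ≤ C)
    (hanti : AntitoneOn (fun x => |deriv g x|) (Ioo a b)) {x : ℝ} (hx : x ∈ Ioo a b) :
    (x - a) * |deriv g x| ≤ 2 * C := by
  have key : ∀ y ∈ Ioo a x, (x - y) * |deriv g x| ≤ 2 * C := by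
    intro y hy
    have hy' : y ∈ Ioo a b := ⟨hy.1, hy.2.trans hx.2⟩
    have hsub : Icc y x ⊆ Ioo a b := Icc_subset_Ioo hy.1 hx.2
    obtain ⟨c, hc, hslope⟩ := exists_deriv_eq_slope g hy.2
      (fun z hz => (hg z (hsub hz)).continuousAt.continuousWithinAt)
      (fun z hz => (hg z (hsub (Ioo_subset_Icc_self hz))).differentiableWithinAt)
    have hpos : 0 < x - y := sub_pos.2 hy.2
    calc (x - y) * |deriv g x| ≤ (x - y) * |deriv g c| :=
          mul_le_mul_of_nonneg_left (hanti (hsub (Ioo_subset_Icc_self hc)) hx hc.2.le) hpos.le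
      _ = |g x - g y| := by
          rw [hslope, abs_div, abs_of_pos hpos, mul_div_cancel₀ _ hpos.ne']
      _ ≤ |g x| + |g y| := abs_sub _ _
      _ ≤ 2 * C := by linarith [hC x hx, hC y hy']
  have hlim : Filter.Tendsto (fun y => (x - y) * |deriv g x|) (nhdsWithin a (Ioi a))
      (nhds ((x - a) * |deriv g x|)) :=
    Continuous.tendsto' (by fun_prop) _ _ rfl |>.mono_left nhdsWithin_le_nhds
  exact le_of_tendsto hlim (Filter.eventually_of_mem (Ioo_mem_nhdsGT hx.1) key)

/-- If `f : (0,1) → ℝ` is `(r+1)` times differentiable with `|f⁽ʳ⁾| ≤ 1`, and `f⁽ʳ⁺¹⁾` has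
constant sign with `|f⁽ʳ⁺¹⁾|` non-increasing on `(0,1)`, then `x * |f⁽ʳ⁺¹⁾ x| ≤ 2`. -/
theorem xmul_deriv_bound (r : ℕ) (f : ℝ → ℝ)
    (hdiff : ∀ k ≤ r, ∀ x ∈ Set.Ioo (0:ℝ) 1, DifferentiableAt ℝ (deriv^[k] f) x)
    (hbound : ∀ x ∈ Set.Ioo (0:ℝ) 1, |deriv^[r] f x| ≤ 1)
    (hsign : (∀ x ∈ Set.Ioo (0:ℝ) 1, 0 ≤ deriv^[r + 1] f x) ∨
             (∀ x ∈ Set.Ioo (0:ℝ) 1, deriv^[r + 1] f x ≤ 0))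
    (hdecr : ∀ x ∈ Set.Ioo (0:ℝ) 1, ∀ y ∈ Set.Ioo (0:ℝ) 1, x ≤ y →
      |deriv^[r + 1] f y| ≤ |deriv^[r + 1] f x|) :
    ∀ x ∈ Set.Ioo (0:ℝ) 1, x * |deriv^[r + 1] f x| ≤ 2 := by
  intro x hx
  simp only [Function.iterate_succ_apply'] at hdecr ⊢
  simpa using sub_mul_abs_deriv_le_two_mul (hdiff r le_rfl) hbound hdecr hx
end

section
/- For every integer r ≥ 1 there exists a constant C(r) < ∞, depending only on r, with the following property. Let f : (0,1) → (0,1) be (r+1) times differentiable with ‖f‖_r := max_{0 ≤ k ≤ r} ‖f^{(k)}‖_∞ ≤ 1, such that f^{(r+1)} has constant sign on (0,1) and |f^{(r+1)}| is decreasing on (0,1). Let h(x) = x². Then for all x ∈ (0,1), |(f ∘ h)^{(r+1)}(x)| ≤ C(r) + 2^{r+2}. -/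
open Set

open Polynomial in
/-- The coefficient of `f⁽ᵏ⁾(x²)` in the `n`-th derivative of `x ↦ f (x²)`. -/
noncomputable def compSquareCoeff : ℕ → ℕ → ℝ[X]
  | 0, 0 => 1
  | 0, _ + 1 => 0
  | n + 1, 0 => derivative (compSquareCoeff n 0)
  | n + 1, k + 1 => derivative (compSquareCoeff n (k + 1)) + C 2 * X * compSquareCoeff n k

lemma compSquareCoeff_eq_zero {n k : ℕ} (h : n < k) : compSquareCoeff n k = 0 := by
  induction n generalizing k with
  | zero =>
    obtain ⟨k, rfl⟩ := Nat.exists_eq_succ_of_ne_zero h.ne'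
    rfl
  | succ n ih =>
    obtain ⟨k, rfl⟩ := Nat.exists_eq_succ_of_ne_zero (Nat.ne_zero_of_lt h)
    simp [compSquareCoeff, ih (show n < k by omega), ih (show n < k + 1 by omega)]

lemma compSquareCoeff_self (n : ℕ) :
    compSquareCoeff n n = (Polynomial.C 2 * Polynomial.X) ^ n := by
  induction n with
  | zero => rfl
  | succ n ih =>
    rw [compSquareCoeff, compSquareCoeff_eq_zero n.lt_succ_self, ih, map_zero, zero_add,
      pow_succ']

lemma sq_mem_Ioo_zero_one {x : ℝ} (hx : x ∈ Ioo (0 : ℝ) 1) : x ^ 2 ∈ Ioo (0 : ℝ) 1 :=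
  ⟨pow_pos hx.1 2, pow_lt_one₀ hx.1.le hx.2 two_ne_zero⟩

lemma iterate_deriv_comp_square {f : ℝ → ℝ} {n : ℕ}
    (hf : ∀ k < n, ∀ x ∈ Ioo (0 : ℝ) 1, DifferentiableAt ℝ (deriv^[k] f) x) :
    ∀ x ∈ Ioo (0 : ℝ) 1, deriv^[n] (fun t => f (t ^ 2)) x =
      ∑ k ∈ Finset.range (n + 1), (compSquareCoeff n k).eval x * deriv^[k] f (x ^ 2) := by
  induction n with
  | zero => intro x _; simp [compSquareCoeff]
  | succ n ih =>
    intro x hx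
    have hev := Filter.eventuallyEq_of_mem (Ioo_mem_nhds hx.1 hx.2)
      (ih fun k hk => hf k (by omega))
    rw [Function.iterate_succ_apply', hev.deriv_eq]
    have hterm : ∀ k ∈ Finset.range (n + 1), HasDerivAt
        (fun t => (compSquareCoeff n k).eval t * deriv^[k] f (t ^ 2))
        ((compSquareCoeff n k).derivative.eval x * deriv^[k] f (x ^ 2) +
          2 * x * (compSquareCoeff n k).eval x * deriv^[k + 1] f (x ^ 2)) x := by
      intro k hk
      have hd := (hf k (Finset.mem_range.mp hk) _ (sq_mem_Ioo_zero_one hx)).hasDerivAt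
      have hc : HasDerivAt (fun t => deriv^[k] f (t ^ 2))
          (deriv (deriv^[k] f) (x ^ 2) * (2 * x)) x := by
        simpa [Function.comp_def] using HasDerivAt.comp (h := fun t => t ^ 2) x hd (hasDerivAt_pow 2 x)
      refine (((compSquareCoeff n k).hasDerivAt x).mul hc).congr_deriv ?_
      rw [Function.iterate_succ_apply']
      ring
    rw [(HasDerivAt.fun_sum hterm).deriv, Finset.sum_add_distrib,
      Finset.sum_range_succ' _ (n + 1), Finset.sum_range_succ' _ n]
    simp only [compSquareCoeff, Polynomial.eval_add, Polynomial.eval_mul, Polynomial.eval_C,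
      Polynomial.eval_X, add_mul, Finset.sum_add_distrib]
    rw [Finset.sum_range_succ (fun k => (compSquareCoeff n (k + 1)).derivative.eval x * _) n,
      compSquareCoeff_eq_zero n.lt_succ_self]
    simp only [map_zero, Polynomial.eval_zero, zero_mul, add_zero]
    ring

lemma abs_deriv_mul_le_of_antitone {g : ℝ → ℝ}
    (hg : ∀ x ∈ Ioo (0 : ℝ) 1, DifferentiableAt ℝ g x)
    (hb : ∀ x ∈ Ioo (0 : ℝ) 1, |g x| ≤ 1)
    (ha : ∀ x ∈ Ioo (0 : ℝ) 1, ∀ y ∈ Ioo (0 : ℝ) 1, x ≤ y → |deriv g y| ≤ |deriv g x|)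
    {y : ℝ} (hy : y ∈ Ioo (0 : ℝ) 1) : |deriv g y| * y ≤ 4 := by
  have hmem : ∀ z ∈ Icc (y / 2) y, z ∈ Ioo (0 : ℝ) 1 := fun z hz =>
    ⟨(half_pos hy.1).trans_le hz.1, hz.2.trans_lt hy.2⟩
  have hlt : y / 2 < y := half_lt_self hy.1
  obtain ⟨c, hc, hcd⟩ := exists_deriv_eq_slope g hlt
    (fun z hz => (hg z (hmem z hz)).continuousAt.continuousWithinAt)
    (fun z hz => (hg z (hmem z (Ioo_subset_Icc_self hz))).differentiableWithinAt)
  have hle := ha c (hmem c (Ioo_subset_Icc_self hc)) y hy hc.2.le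
  have hslope : |deriv g c| * (y / 2) = |g y - g (y / 2)| := by
    rw [hcd, abs_div, abs_of_pos (sub_pos.mpr hlt), sub_half,
      div_mul_cancel₀ _ (half_pos hy.1).ne']
  have hdiff := abs_sub (g y) (g (y / 2))
  have h₁ := hb y hy
  have h₂ := hb (y / 2) (hmem _ ⟨le_rfl, hlt.le⟩)
  have := mul_le_mul_of_nonneg_right hle (half_pos hy.1).le
  linarith

/-- For every `r ≥ 1` there is `C(r)` such that if `f : (0,1) → (0,1)` is `(r+1)` times
differentiable with `‖f‖_r ≤ 1`, `f⁽ʳ⁺¹⁾` of constant sign and `|f⁽ʳ⁺¹⁾|` non-increasing,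
then `|(f ∘ h)⁽ʳ⁺¹⁾(x)| ≤ C(r) + 2^(r+2)` on `(0,1)`, where `h x = x²`. -/
theorem comp_square_deriv_bound (r : ℕ) (hr : 1 ≤ r) :
    ∃ C : ℝ, ∀ f : ℝ → ℝ,
      (∀ x ∈ Set.Ioo (0:ℝ) 1, f x ∈ Set.Ioo (0:ℝ) 1) →
      (∀ k ≤ r, ∀ x ∈ Set.Ioo (0:ℝ) 1, DifferentiableAt ℝ (deriv^[k] f) x) →
      (∀ k ≤ r, ∀ x ∈ Set.Ioo (0:ℝ) 1, |deriv^[k] f x| ≤ 1) →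
      ((∀ x ∈ Set.Ioo (0:ℝ) 1, 0 ≤ deriv^[r + 1] f x) ∨
       (∀ x ∈ Set.Ioo (0:ℝ) 1, deriv^[r + 1] f x ≤ 0)) →
      (∀ x ∈ Set.Ioo (0:ℝ) 1, ∀ y ∈ Set.Ioo (0:ℝ) 1, x ≤ y →
        |deriv^[r + 1] f y| ≤ |deriv^[r + 1] f x|) →
      ∀ x ∈ Set.Ioo (0:ℝ) 1,
        |deriv^[r + 1] (fun t => f (t ^ 2)) x| ≤ C + 2 ^ (r + 2) := by
  choose B hB using fun k => (isCompact_Icc (a := (0 : ℝ)) (b := 1)).exists_bound_of_continuousOn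
    (compSquareCoeff (r + 1) k).continuous.continuousOn
  refine ⟨∑ k ∈ Finset.range (r + 1), B k + 2 ^ (r + 2), ?_⟩
  intro f _ hd hb _ ha x hx
  have hx2 := sq_mem_Ioo_zero_one hx
  rw [iterate_deriv_comp_square (fun k hk => hd k (by omega)) x hx, Finset.sum_range_succ]
  have hlow : |∑ k ∈ Finset.range (r + 1),
      (compSquareCoeff (r + 1) k).eval x * deriv^[k] f (x ^ 2)| ≤
        ∑ k ∈ Finset.range (r + 1), B k := by
    refine (Finset.abs_sum_le_sum_abs _ _).trans (Finset.sum_le_sum fun k hk => ?_)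
    have hBk := hB k x (Ioo_subset_Icc_self hx)
    rw [Real.norm_eq_abs] at hBk
    rw [abs_mul]
    exact (mul_le_of_le_one_right (abs_nonneg _)
      (hb k (Nat.lt_succ_iff.mp (Finset.mem_range.mp hk)) _ hx2)).trans hBk
  have htop : |(compSquareCoeff (r + 1) (r + 1)).eval x * deriv^[r + 1] f (x ^ 2)| ≤
      2 ^ (r + 2) + 2 ^ (r + 2) := by
    rw [compSquareCoeff_self]
    simp only [Function.iterate_succ_apply'] at ha ⊢
    have hD := abs_deriv_mul_le_of_antitone (hd r le_rfl) (hb r le_rfl) ha hx2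
    obtain ⟨s, rfl⟩ := Nat.exists_eq_add_of_le' hr
    have hxs : x ^ s ≤ 1 := pow_le_one₀ hx.1.le hx.2.le
    simp only [Polynomial.eval_pow, Polynomial.eval_mul, Polynomial.eval_C, Polynomial.eval_X]
    rw [abs_mul, abs_of_pos (pow_pos (mul_pos two_pos hx.1) _)]
    calc (2 * x) ^ (s + 1 + 1) * |deriv (deriv^[s + 1] f) (x ^ 2)|
        = 2 ^ (s + 2) * (x ^ s * (|deriv (deriv^[s + 1] f) (x ^ 2)| * x ^ 2)) := by ring
      _ ≤ 2 ^ (s + 2) * (1 * 4) := by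
        have := hx2.1.le
        gcongr
      _ = 2 ^ (s + 1 + 2) + 2 ^ (s + 1 + 2) := by ring
  refine (abs_add_le _ _).trans ?_
  linarith
end
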